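/- arXiv:2012.04255 — 2 statements merged into one kernel-verified Lean document; each statement's English description precedes it below -/
import Mathlib

section
/- (Proposition 3.9, orbit degree, linear-slice count form.) Let I ⊆ {1,…,k} be such that the submatrix P''_{:,I} of P'' with columns indexed by I has rank k−n (this holds whenever the point z_I = Σ_{i∈I}e_i lies over the locus where the Cox quotient is geometric). Define: q_I = the index in ℤ^{k−n} of the subgroup generated by the columns {P''_{:,i} : i ∈ I}; P^I : ℤ^I → ℤᵏ/im(Fᵀ) the homomorphism sending a = (a_i)_{i∈I} to the class of Σ_{i∈I} a_i e_i, and s_I = the order of the torsion subgroup of ℤ^I/ker(P^I) (equivalently, the product of the invariant factors of the subgroup ker P^I of ℤ^I); and Δ^I = conv({0} ∪ {P''_{:,i} : i ∈ I}) ⊂ ℝ^{k−n}. Then for every z ∈ ℂᵏ with z_i ≠ 0 exactly for i ∈ I, there exists a nonzero polynomial D in the entries of (A,b) ∈ ℂ^{(k−n)×k} × ℂ^{k−n} such that whenever D(A,b) ≠ 0, the set {x ∈ ℂᵏ : x ∈ G·z and A·x + b = 0} is finite and its cardinality N satisfies q_I · N = s_I · (k−n)! · vol(Δ^I). -/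
open scoped BigOperators

namespace GenericSlice
open MvPolynomial

section Filtration

variable {K R σ τ : Type*} [Field K] [CommRing R] [Algebra K R]

/-- The span of `1` and a family `y`. -/
def affSpan (K : Type*) {R σ : Type*} [Field K] [CommRing R] [Algebra K R] (y : σ → R) :
    Submodule K R :=
  Submodule.span K (insert 1 (Set.range y))

theorem one_mem_affSpan (y : σ → R) : (1 : R) ∈ affSpan K y :=
  Submodule.subset_span (Set.mem_insert _ _)

theorem mem_affSpan (y : σ → R) (i : σ) : y i ∈ affSpan K y :=
  Submodule.subset_span (Set.mem_insert_of_mem _ ⟨i, rfl⟩)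

theorem affSpan_le {y : σ → R} {V : Submodule K R} (h1 : 1 ∈ V) (h : ∀ i, y i ∈ V) :
    affSpan K y ≤ V := by
  refine Submodule.span_le.2 (Set.insert_subset h1 ?_)
  rintro _ ⟨i, rfl⟩
  exact h i

theorem pow_le_pow_of_one_mem {V : Submodule K R} (h : 1 ∈ V) {m n : ℕ} (hmn : m ≤ n) :
    V ^ m ≤ V ^ n :=
  pow_le_pow_right' (Submodule.one_le.2 h) hmn

theorem affSpan_pow (y : σ → R) (r : ℕ) :
    affSpan K y ^ r = (restrictTotalDegree σ K r).map (aeval y).toLinearMap := by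
  apply le_antisymm
  · induction r with
    | zero =>
      rw [pow_zero, Submodule.one_le]
      refine ⟨1, ?_, by simp⟩
      rw [SetLike.mem_coe, mem_restrictTotalDegree]
      simp
    | succ r ih =>
      rw [pow_succ, Submodule.mul_le]
      intro a ha b hb
      obtain ⟨p, hp, rfl⟩ := ih ha
      have : affSpan K y ≤ (restrictTotalDegree σ K 1).map (aeval y).toLinearMap := by
        apply affSpan_le
        · refine ⟨1, ?_, by simp⟩
          rw [SetLike.mem_coe, mem_restrictTotalDegree]
          simp
        · intro i
          refine ⟨X i, ?_, by simp⟩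
          rw [SetLike.mem_coe, mem_restrictTotalDegree]
          simp
      obtain ⟨q, hq, rfl⟩ := this hb
      rw [SetLike.mem_coe, mem_restrictTotalDegree] at hp hq
      refine ⟨p * q, ?_, by simp⟩
      rw [SetLike.mem_coe, mem_restrictTotalDegree]
      exact (totalDegree_mul _ _).trans (add_le_add hp hq)
  · rw [restrictTotalDegree, restrictSupport_eq_span, Submodule.map_span, Submodule.span_le]
    rintro _ ⟨_, ⟨n, hn, rfl⟩, rfl⟩
    simp only [AlgHom.toLinearMap_apply, aeval_monomial, map_one, one_mul, SetLike.mem_coe]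
    refine pow_le_pow_of_one_mem (one_mem_affSpan y) hn ?_
    classical
    clear hn
    induction n using Finsupp.induction_linear with
    | zero => simpa using ⟨1, map_one _⟩
    | add f g hf hg =>
      rw [Finsupp.prod_add_index' (by simp) (by simp [pow_add]),
        Finsupp.sum_add_index' (by simp) (by simp), pow_add]
      exact Submodule.mul_mem_mul hf hg
    | single i e =>
      simpa using Submodule.pow_mem_pow _ (mem_affSpan y i) e

/-- `V` is a reduction of `W`: it is contained in `W` and its products with a power of `W` fill
the next power of `W`. -/
def IsReduction (V W : Submodule K R) : Prop :=
  V ≤ W ∧ ∃ r, W ^ (r + 1) ≤ V * W ^ r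

theorem IsReduction.refl (W : Submodule K R) : IsReduction W W :=
  ⟨le_rfl, 0, by simp⟩

theorem IsReduction.pow_add_le {V W : Submodule K R} {r : ℕ} (h : W ^ (r + 1) ≤ V * W ^ r)
    (m : ℕ) : W ^ (r + m) ≤ V ^ m * W ^ r := by
  induction m with
  | zero => simp
  | succ m ih =>
    calc W ^ (r + (m + 1)) = W ^ (r + m) * W := by rw [← add_assoc, pow_succ]
      _ ≤ V ^ m * W ^ r * W := mul_le_mul' ih le_rfl
      _ = V ^ m * W ^ (r + 1) := by rw [mul_assoc, pow_succ]
      _ ≤ V ^ m * (V * W ^ r) := mul_le_mul' le_rfl h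
      _ = V ^ (m + 1) * W ^ r := by rw [← mul_assoc, pow_succ]

theorem IsReduction.trans {U V W : Submodule K R} (h₁ : IsReduction U V) (h₂ : IsReduction V W) :
    IsReduction U W := by
  obtain ⟨hUV, s, hs⟩ := h₁
  obtain ⟨hVW, r, hr⟩ := h₂
  refine ⟨hUV.trans hVW, r + s, ?_⟩
  calc W ^ (r + s + 1) ≤ V ^ (s + 1) * W ^ r := IsReduction.pow_add_le hr (s + 1)
    _ ≤ U * V ^ s * W ^ r := mul_le_mul' hs le_rfl
    _ = U * (W ^ r * V ^ s) := by rw [mul_assoc, mul_comm (V ^ s)]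
    _ ≤ U * (W ^ r * W ^ s) :=
        mul_le_mul' le_rfl (mul_le_mul' le_rfl (pow_le_pow_left' hVW s))
    _ = U * W ^ (r + s) := by rw [← pow_add]

/-- The value at `c` of the homogeneous component of degree `n`, compared with `aeval`. -/
theorem aeval_sub_mem {y y' : σ → R} {u : R} {c : σ → K} (hy : ∀ i, y i = y' i + c i • u)
    (hu : u ∈ affSpan K y) (n : ℕ) (p : MvPolynomial σ K)
    (hp : p.totalDegree ≤ n + 1) :
    aeval y p - eval c (homogeneousComponent (n + 1) p) • u ^ (n + 1) ∈
      affSpan K y' * affSpan K y ^ n := by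
  have key : ∀ s : Multiset σ, ∀ n, s.card = n + 1 →
      (s.map y).prod - (s.map c).prod • u ^ (n + 1) ∈ affSpan K y' * affSpan K y ^ n := by
    intro s
    induction s using Multiset.induction_on with
    | empty => intro n hn; simp at hn
    | cons i s ih =>
      intro n hn
      have hs : s.card = n := by simpa using hn
      have hmem : (s.map y).prod ∈ affSpan K y ^ n := by
        subst hs
        clear ih hn
        induction s using Multiset.induction_on with
        | empty => simpa using ⟨1, map_one _⟩
        | cons j s ih' =>
          rw [Multiset.map_cons, Multiset.prod_cons, Multiset.card_cons, pow_succ']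
          exact Submodule.mul_mem_mul (mem_affSpan y j) ih'
      have e : ((i ::ₘ s).map y).prod - ((i ::ₘ s).map c).prod • u ^ (n + 1) =
          y' i * (s.map y).prod + c i • (u * ((s.map y).prod - (s.map c).prod • u ^ n)) := by
        simp only [Multiset.map_cons, Multiset.prod_cons, hy i, pow_succ, Algebra.smul_def,
          map_mul]
        ring
      rw [e]
      refine add_mem (Submodule.mul_mem_mul (mem_affSpan y' i) hmem) (Submodule.smul_mem _ _ ?_)
      cases n with
      | zero =>
        rw [Multiset.card_eq_zero] at hs
        subst hs
        simp
      | succ n =>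
        have := Submodule.mul_mem_mul hu (ih n hs)
        rwa [mul_left_comm, ← pow_succ'] at this
  have h1 : affSpan K y ^ n ≤ affSpan K y' * affSpan K y ^ n := by
    intro a ha
    have := Submodule.mul_mem_mul (one_mem_affSpan (K := K) y') ha
    rwa [one_mul] at this
  rw [← mem_restrictTotalDegree, restrictTotalDegree, restrictSupport_eq_span] at hp
  induction hp using Submodule.span_induction with
  | zero => simp
  | add a b _ _ ha hb =>
    rw [map_add, map_add, map_add, add_smul, add_sub_add_comm]
    exact add_mem ha hb
  | smul k a _ ha =>
    have : aeval y (k • a) - eval c (homogeneousComponent (n + 1) (k • a)) • u ^ (n + 1) =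
        k • (aeval y a - eval c (homogeneousComponent (n + 1) a) • u ^ (n + 1)) := by
      rw [map_smul, map_smul, smul_eval, smul_sub, mul_smul]
    rw [this]
    exact Submodule.smul_mem _ _ ha
  | mem q hq =>
    obtain ⟨m, hm, rfl⟩ := hq
    rw [Set.mem_ofPred_eq] at hm
    change m.degree ≤ n + 1 at hm
    have hmon := isHomogeneous_monomial (σ := σ) (R := K) (d := m) 1 rfl
    rcases hm.lt_or_eq with hm | hm
    · have h0 : homogeneousComponent (n + 1) (monomial m (1 : K)) = 0 := by
        rw [homogeneousComponent_of_mem hmon, if_neg hm.ne']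
      rw [h0]
      simp only [map_zero, zero_smul, sub_zero]
      apply h1
      rw [affSpan_pow]
      refine ⟨_, ?_, rfl⟩
      rw [SetLike.mem_coe, mem_restrictTotalDegree]
      exact hmon.totalDegree_le.trans (by omega)
    · have h0 : homogeneousComponent (n + 1) (monomial m (1 : K)) = monomial m 1 := by
        rw [homogeneousComponent_of_mem hmon, if_pos hm.symm]
      rw [h0]
      have := key (Finsupp.toMultiset m) n (by rw [Finsupp.card_toMultiset]; exact hm)
      rw [aeval_monomial, eval_monomial, map_one, one_mul, one_mul]
      rwa [Finsupp.toMultiset_map, Finsupp.toMultiset_map, Finsupp.prod_toMultiset,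
        Finsupp.prod_toMultiset, Finsupp.prod_mapDomain_index (by simp) (by simp [pow_add]),
        Finsupp.prod_mapDomain_index (by simp) (by simp [pow_add])] at this

/-- One step of Noether normalization by linear forms. -/
theorem exists_isReduction_of_aeval_eq_zero [Infinite K] [Nontrivial R] {m : ℕ}
    (y : Fin (m + 1) → R) (p : MvPolynomial (Fin (m + 1)) K) (hp : p ≠ 0) (hpy : aeval y p = 0) :
    ∃ y' : Fin m → R, (∀ i, y' i ∈ Submodule.span K (Set.range y)) ∧
      IsReduction (affSpan K y') (affSpan K y) := by
  obtain ⟨n, hn⟩ : ∃ n, p.totalDegree = n + 1 := by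
    refine Nat.exists_eq_succ_of_ne_zero fun h => hp ?_
    rw [totalDegree_eq_zero_iff_eq_C] at h
    rw [h, aeval_C] at hpy
    rw [h, (FaithfulSMul.algebraMap_injective K R) (hpy.trans (map_zero _).symm), map_zero]
  have hq : homogeneousComponent (n + 1) p ≠ 0 := by
    intro h
    have := (Finset.sup_lt_iff (s := p.support) (f := fun s => s.sum fun _ e => e)
      (a := n + 1) (by simp)).2 fun b hb => by
        refine lt_of_le_of_ne (hn ▸ le_totalDegree hb) fun hbn => mem_support_iff.1 hb ?_
        have := congrArg (coeff b) h
        rwa [coeff_homogeneousComponent, if_pos (show b.degree = n + 1 from hbn), coeff_zero] at this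
    exact (this.trans_le hn.ge).ne rfl
  obtain ⟨c, hc⟩ : ∃ c, eval c (homogeneousComponent (n + 1) p) ≠ 0 := by
    by_contra! h
    exact hq (MvPolynomial.funext fun c => by rw [h c, map_zero])
  obtain ⟨j, hj⟩ : ∃ j, c j ≠ 0 := by
    by_contra! h
    have hc0 : c = 0 := funext h
    apply hc
    rw [hc0]
    have := (homogeneousComponent_isHomogeneous (n + 1) p)
    rw [eval_zero, constantCoeff_eq, this.coeff_eq_zero (by simp)]
  set u : R := (c j)⁻¹ • y j with hu
  set z : Fin (m + 1) → R := fun i => y i - c i • u with hz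
  have hyz : ∀ i, y i = z i + c i • u := fun i => by simp [hz]
  have huy : u ∈ affSpan K y := Submodule.smul_mem _ _ (mem_affSpan y j)
  have hzj : z j = 0 := by simp [hz, hu, smul_smul, hj]
  have hzspan : ∀ i, z i ∈ Submodule.span K (Set.range y) := fun i =>
    sub_mem (Submodule.subset_span ⟨i, rfl⟩)
      (Submodule.smul_mem _ _ (Submodule.smul_mem _ _ (Submodule.subset_span ⟨j, rfl⟩)))
  have hzle : affSpan K z ≤ affSpan K y := affSpan_le (one_mem_affSpan y) fun i =>
    Submodule.span_mono (Set.subset_insert _ _) (hzspan i)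
  have hred : IsReduction (affSpan K z) (affSpan K y) := by
    refine ⟨hzle, n, ?_⟩
    have hun : u ^ (n + 1) ∈ affSpan K z * affSpan K y ^ n := by
      have := aeval_sub_mem hyz huy n p hn.le
      rw [hpy, zero_sub, neg_mem_iff] at this
      have := Submodule.smul_mem _ (eval c (homogeneousComponent (n + 1) p))⁻¹ this
      rwa [smul_smul, inv_mul_cancel₀ hc, one_smul] at this
    nth_rw 1 [affSpan_pow]
    rintro _ ⟨q, hq', rfl⟩
    rw [SetLike.mem_coe, mem_restrictTotalDegree] at hq'
    have := add_mem (aeval_sub_mem hyz huy n q hq') (Submodule.smul_mem _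
      (eval c (homogeneousComponent (n + 1) q)) hun)
    simpa using this
  refine ⟨fun i => z (j.succAbove i), fun i => hzspan _, ?_⟩
  convert hred using 1
  apply le_antisymm
  · exact affSpan_le (one_mem_affSpan z) fun i => mem_affSpan z _
  · refine affSpan_le (one_mem_affSpan _) fun i => ?_
    rcases Fin.eq_self_or_eq_succAbove j i with rfl | ⟨i', rfl⟩
    · rw [hzj]; exact zero_mem _
    · exact mem_affSpan (fun i => z (j.succAbove i)) i'

end Filtration
end GenericSlice

namespace GenericSlice
open MvPolynomial

section Dimension

open Filter Topology

variable {K R σ : Type*} [Field K] [CommRing R] [Algebra K R]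

theorem card_degree_le (m r : ℕ) :
    Nat.card {n : Fin m →₀ ℕ | (n.sum fun _ e => e) ≤ r} = (r + m).choose m := by
  classical
  have : {n : Fin m →₀ ℕ | (n.sum fun _ e => e) ≤ r} =
      ↑((Finset.range (r + 1)).biUnion fun i => (Finset.univ : Finset (Fin m)).finsuppAntidiag i) := by
    ext n
    simp [Finset.mem_finsuppAntidiag, Finsupp.sum_fintype]
  rw [this, Nat.card_eq_card_toFinset, Finset.toFinset_coe, Finset.card_biUnion]
  · simp_rw [Finset.card_finsuppAntidiag_nat_eq_multichoose, Finset.card_univ, Fintype.card_fin]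
    rw [Nat.sum_range_multichoose]
  · intro i _ j _ hij
    rw [Function.onFun, Finset.disjoint_left]
    intro a ha hb
    rw [Finset.mem_finsuppAntidiag] at ha hb
    exact hij (ha.1.symm.trans hb.1)

theorem finrank_restrictTotalDegree (m r : ℕ) :
    Module.finrank K (restrictTotalDegree (Fin m) K r) = (r + m).choose m := by
  rw [restrictTotalDegree, Module.finrank_eq_nat_card_basis (basisRestrictSupport K _)]
  exact card_degree_le m r

theorem finrank_affSpan_pow_le {m : ℕ} (y : Fin m → R) (r : ℕ) :
    Module.finrank K ↥(affSpan K y ^ r) ≤ (r + m).choose m := by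
  rw [affSpan_pow, ← finrank_restrictTotalDegree (K := K)]
  exact Submodule.finrank_map_le _ _

theorem finrank_affSpan_pow {m : ℕ} {y : Fin m → R} (hy : AlgebraicIndependent K y) (r : ℕ) :
    Module.finrank K ↥(affSpan K y ^ r) = (r + m).choose m := by
  rw [affSpan_pow, ← finrank_restrictTotalDegree (K := K)]
  exact (LinearEquiv.finrank_eq (Submodule.equivMapOfInjective (aeval y).toLinearMap hy _)).symm

instance finiteDimensional_affSpan_pow [Finite σ] (y : σ → R) (r : ℕ) :
    FiniteDimensional K ↥(affSpan K y ^ r) := by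
  rw [affSpan_pow]
  infer_instance

theorem finrank_mul_le (V W : Submodule K R) [FiniteDimensional K V] [FiniteDimensional K W] :
    Module.finrank K ↥(V * W) ≤ Module.finrank K V * Module.finrank K W := by
  rw [← Submodule.mulMap_range, ← Module.finrank_tensorProduct]
  exact LinearMap.finrank_range_le _

theorem tendsto_add_choose_div_pow (m c : ℕ) :
    Tendsto (fun r : ℕ => ((r + c + m).choose m : ℝ) / (r : ℝ) ^ m) atTop
      (𝓝 (1 / (m.factorial : ℝ))) := by
  have h1 : Tendsto (fun r : ℕ => (r.choose m : ℝ) / ((r : ℝ) ^ m / m.factorial)) atTop (𝓝 1) := by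
    have := (Asymptotics.isEquivalent_iff_tendsto_one ?_).1 (isEquivalent_choose m)
    · exact this
    · filter_upwards [eventually_gt_atTop 0] with r hr
      positivity
  have h2 := h1.comp (tendsto_add_atTop_nat (c + m))
  have h3 : Tendsto (fun r : ℕ => (((r + (c + m) : ℕ) : ℝ) / r) ^ m) atTop (𝓝 (1 ^ m)) := by
    refine Tendsto.pow ?_ m
    have : Tendsto (fun r : ℕ => 1 + ((c + m : ℕ) : ℝ) / r) atTop (𝓝 (1 + 0)) :=
      tendsto_const_nhds.add (tendsto_const_div_atTop_nhds_zero_nat _)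
    rw [add_zero] at this
    refine this.congr' ?_
    filter_upwards [eventually_gt_atTop 0] with r hr
    have : (r : ℝ) ≠ 0 := by positivity
    push_cast
    field_simp
  have h4 := (h2.mul h3).mul_const (1 / (m.factorial : ℝ))
  rw [one_pow, one_mul, one_mul] at h4
  refine h4.congr' ?_
  filter_upwards [eventually_gt_atTop 0] with r hr
  have h5 : (r : ℝ) ≠ 0 := by positivity
  have h6 : ((r + (c + m) : ℕ) : ℝ) ≠ 0 := by positivity
  simp only [Function.comp]
  rw [div_pow, ← add_assoc] at *
  field_simp

/-- Shifting the argument does not change the leading coefficient of polynomial growth. -/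
theorem tendsto_shift {u : ℕ → ℝ} {v : ℝ} {d : ℕ} (c : ℕ)
    (h : Tendsto (fun r : ℕ => u r / (r : ℝ) ^ d) atTop (𝓝 v)) :
    Tendsto (fun r : ℕ => u (r + c) / (r : ℝ) ^ d) atTop (𝓝 v) := by
  have h2 := h.comp (tendsto_add_atTop_nat c)
  have h3 : Tendsto (fun r : ℕ => (((r + c : ℕ) : ℝ) / r) ^ d) atTop (𝓝 (1 ^ d)) := by
    refine Tendsto.pow ?_ d
    have : Tendsto (fun r : ℕ => 1 + (c : ℝ) / r) atTop (𝓝 (1 + 0)) :=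
      tendsto_const_nhds.add (tendsto_const_div_atTop_nhds_zero_nat _)
    rw [add_zero] at this
    refine this.congr' ?_
    filter_upwards [eventually_gt_atTop 0] with r hr
    have : (r : ℝ) ≠ 0 := by positivity
    push_cast
    field_simp
  have h4 := h2.mul h3
  rw [one_pow, mul_one] at h4
  refine h4.congr' ?_
  filter_upwards [eventually_gt_atTop 0] with r hr
  have h5 : (r : ℝ) ≠ 0 := by positivity
  have h6 : ((r + c : ℕ) : ℝ) ≠ 0 := by positivity
  simp only [Function.comp]
  rw [div_pow]
  field_simp

theorem tendsto_choose_div_pow_of_lt {m d : ℕ} (h : m < d) :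
    Tendsto (fun r : ℕ => ((r + m).choose m : ℝ) / (r : ℝ) ^ d) atTop (𝓝 0) := by
  obtain ⟨e, rfl⟩ := Nat.exists_eq_add_of_lt h
  have h1 := tendsto_add_choose_div_pow m 0
  have h2 : Tendsto (fun r : ℕ => (1 / (r : ℝ)) ^ (e + 1)) atTop (𝓝 (0 ^ (e + 1))) :=
    (tendsto_const_div_atTop_nhds_zero_nat 1).pow _
  have h3 := h1.mul h2
  rw [zero_pow (by omega), mul_zero] at h3
  refine h3.congr' ?_
  filter_upwards [eventually_gt_atTop 0] with r hr
  have h5 : (r : ℝ) ≠ 0 := by positivity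
  rw [add_zero, one_div, inv_pow, add_assoc m e 1, pow_add (r : ℝ) m (e + 1)]
  field_simp

/-- A reduction of a space of growth `r ^ d` has at least `d` generators. -/
theorem le_of_isReduction {W : Submodule K R} {d m : ℕ} {v : ℝ} (hv : 0 < v)
    (hfin : ∀ r, FiniteDimensional K ↥(W ^ r))
    (h : Tendsto (fun r : ℕ => (Module.finrank K ↥(W ^ r) : ℝ) / (r : ℝ) ^ d) atTop (𝓝 v))
    {y : Fin m → R} (hy : IsReduction (affSpan K y) W) : d ≤ m := by
  by_contra! hlt
  obtain ⟨-, r₀, hr₀⟩ := hy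
  have h1 := tendsto_shift r₀ h
  have h2 := (tendsto_choose_div_pow_of_lt hlt).mul_const (Module.finrank K ↥(W ^ r₀) : ℝ)
  rw [zero_mul] at h2
  refine hv.not_ge (le_of_tendsto_of_tendsto' h1 h2 fun r => ?_)
  rw [div_mul_eq_mul_div]
  gcongr
  norm_cast
  have := hfin r₀
  have := hfin (r₀ + r)
  have h3 := IsReduction.pow_add_le hr₀ r
  rw [add_comm r r₀]
  have : FiniteDimensional K ↥(affSpan K y ^ r * W ^ r₀) := by
    rw [← Submodule.mulMap_range]
    infer_instance
  calc _ ≤ Module.finrank K ↥(affSpan K y ^ r * W ^ r₀) := Submodule.finrank_mono h3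
    _ ≤ _ := finrank_mul_le _ _
    _ ≤ _ := by gcongr; exact finrank_affSpan_pow_le y r

/-- A space of growth `r ^ d` contains at most `d` algebraically independent elements. -/
theorem le_of_algebraicIndependent {W : Submodule K R} {d m : ℕ} {v : ℝ}
    (hfin : ∀ r, FiniteDimensional K ↥(W ^ r))
    (h : Tendsto (fun r : ℕ => (Module.finrank K ↥(W ^ r) : ℝ) / (r : ℝ) ^ d) atTop (𝓝 v))
    {y : Fin m → R} (hy : AlgebraicIndependent K y) (hyW : affSpan K y ≤ W) : m ≤ d := by
  by_contra! hlt
  obtain ⟨e, rfl⟩ := Nat.exists_eq_add_of_lt hlt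
  have h1 := tendsto_add_choose_div_pow (d + e + 1) 0
  have h2 : Tendsto (fun r : ℕ => (1 / (r : ℝ)) ^ (e + 1)) atTop (𝓝 (0 ^ (e + 1))) :=
    (tendsto_const_div_atTop_nhds_zero_nat 1).pow _
  have h3 := h.mul h2
  rw [zero_pow (by omega), mul_zero] at h3
  have hpos : 0 < 1 / (((d + e + 1).factorial : ℕ) : ℝ) := by positivity
  refine hpos.not_ge (le_of_tendsto_of_tendsto h1 h3 ?_)
  filter_upwards [eventually_gt_atTop 0] with r hr
  rw [one_div, inv_pow, ← div_eq_mul_inv, div_div, ← pow_add, ← add_assoc d e 1]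
  gcongr
  have := hfin r
  rw [add_zero, ← finrank_affSpan_pow hy r]
  exact Submodule.finrank_mono (pow_le_pow_left' hyW r)

/-- Noether normalization by `d` linear forms for a space of growth `r ^ d`. -/
theorem exists_isReduction [Infinite K] [Nontrivial R] {ι : Type*} [Finite ι] (x : ι → R) {d : ℕ}
    {v : ℝ}
    (h : Tendsto (fun r : ℕ => (Module.finrank K ↥(affSpan K x ^ r) : ℝ) / (r : ℝ) ^ d)
      atTop (𝓝 v)) :
    ∃ y : Fin d → R, (∀ i, y i ∈ Submodule.span K (Set.range x)) ∧
      IsReduction (affSpan K y) (affSpan K x) := by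
  have hle : ∀ {m : ℕ} {y : Fin m → R}, (∀ i, y i ∈ Submodule.span K (Set.range x)) →
      affSpan K y ≤ affSpan K x := fun {m y} hy => affSpan_le (one_mem_affSpan x) fun i =>
    Submodule.span_mono (Set.subset_insert _ _) (hy i)
  have key : ∀ m, ∀ y : Fin (d + m) → R, (∀ i, y i ∈ Submodule.span K (Set.range x)) →
      IsReduction (affSpan K y) (affSpan K x) → ∃ y : Fin d → R,
      (∀ i, y i ∈ Submodule.span K (Set.range x)) ∧
      IsReduction (affSpan K y) (affSpan K x) := by
    intro m
    induction m with
    | zero => exact fun y h1 h2 => ⟨y, h1, h2⟩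
    | succ m ih =>
      intro (y : Fin (d + m + 1) → R) h1 h2
      have hdep : ¬ AlgebraicIndependent K y := fun hi => by
        have := le_of_algebraicIndependent (fun r => inferInstance) h hi (hle h1)
        omega
      rw [algebraicIndependent_iff] at hdep
      push Not at hdep
      obtain ⟨p, hpy, hp⟩ := hdep
      obtain ⟨y', hy', hred⟩ := exists_isReduction_of_aeval_eq_zero y p hp hpy
      refine ih y' (fun i => ?_) (hred.trans h2)
      refine Submodule.span_le.2 ?_ (hy' i)
      rintro _ ⟨j, rfl⟩
      exact h1 j
  let e := Finite.equivFin ι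
  refine key (Nat.card ι) (Fin.append (fun _ => 0) (x ∘ e.symm)) ?_ ?_
  · intro i
    refine Fin.addCases (fun i => ?_) (fun i => ?_) i
    · simp
    · simpa using Submodule.subset_span (s := Set.range x) ⟨e.symm i, rfl⟩
  · convert IsReduction.refl (affSpan K x)
    apply le_antisymm
    · refine affSpan_le (one_mem_affSpan _) fun i => ?_
      refine Fin.addCases (fun i => ?_) (fun i => ?_) i
      · simp
      · simpa using mem_affSpan x (e.symm i)
    · refine affSpan_le (one_mem_affSpan _) fun i => ?_
      have := mem_affSpan (K := K) (Fin.append (fun _ : Fin d => (0 : R)) (x ∘ e.symm))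
        (Fin.natAdd d (e i))
      simpa using this

/-- A reduction with `d` generators of a space of growth `r ^ d` has algebraically independent
generators. -/
theorem IsReduction.algebraicIndependent [Infinite K] [Nontrivial R] {W : Submodule K R} {d : ℕ}
    {v : ℝ} (hv : 0 < v) (hfin : ∀ r, FiniteDimensional K ↥(W ^ r))
    (h : Tendsto (fun r : ℕ => (Module.finrank K ↥(W ^ r) : ℝ) / (r : ℝ) ^ d) atTop (𝓝 v))
    {y : Fin d → R} (hy : IsReduction (affSpan K y) W) : AlgebraicIndependent K y := by
  rw [algebraicIndependent_iff]
  by_contra! hdep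
  obtain ⟨p, hpy, hp⟩ := hdep
  cases d with
  | zero =>
    obtain ⟨c, rfl⟩ := C_surjective (R := K) (Fin 0) p
    rw [aeval_C] at hpy
    rw [(FaithfulSMul.algebraMap_injective K R) (hpy.trans (map_zero _).symm), map_zero] at hp
    exact hp rfl
  | succ d =>
    obtain ⟨y', -, hred⟩ := exists_isReduction_of_aeval_eq_zero y p hp hpy
    have := le_of_isReduction hv hfin h (hred.trans hy)
    omega

end Dimension
end GenericSlice

namespace GenericSlice
open MvPolynomial

section Degree

open Filter Topology

variable {K Ω : Type*} [Field K] [Field Ω] [Algebra K Ω]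

theorem aeval_mem_adjoin {d : ℕ} (f : Fin d → Ω) (p : MvPolynomial (Fin d) K) :
    aeval f p ∈ IntermediateField.adjoin K (Set.range f) := by
  apply IntermediateField.algebra_adjoin_le_adjoin
  rw [Algebra.adjoin_range_eq_range_aeval]
  exact ⟨p, rfl⟩

theorem affSpan_pow_le_adjoin {d : ℕ} (f : Fin d → Ω) (s : ℕ) {w : Ω} (hw : w ∈ affSpan K f ^ s) :
    w ∈ IntermediateField.adjoin K (Set.range f) := by
  rw [affSpan_pow] at hw
  obtain ⟨p, -, rfl⟩ := hw
  exact aeval_mem_adjoin f p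

theorem mul_finrank_le {d N : ℕ} {f : Fin d → Ω} (hf : AlgebraicIndependent K f)
    {W : Submodule K Ω} (hfin : ∀ r, FiniteDimensional K ↥(W ^ r)) (hfW : affSpan K f ≤ W)
    {g : Fin N → Ω} {r₀ : ℕ} (hg : ∀ i, g i ∈ W ^ r₀)
    (hli : LinearIndependent (IntermediateField.adjoin K (Set.range f)) g) (s : ℕ) :
    N * (s + d).choose d ≤ Module.finrank K ↥(W ^ (s + r₀)) := by
  let V := restrictTotalDegree (Fin d) K s
  let φ : (Fin N → V) →ₗ[K] Ω :=
    { toFun := fun p => ∑ i, aeval f (p i : MvPolynomial (Fin d) K) * g i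
      map_add' := fun p q => by simp [add_mul, Finset.sum_add_distrib]
      map_smul' := fun c p => by simp [Finset.smul_sum] }
  have hφ : ∀ p, φ p ∈ W ^ (s + r₀) := fun p => by
    change ∑ i, aeval f (p i : MvPolynomial (Fin d) K) * g i ∈ W ^ (s + r₀)
    refine Submodule.sum_mem (W ^ (s + r₀)) fun i _ => ?_
    rw [pow_add]
    refine Submodule.mul_mem_mul (pow_le_pow_left' hfW s ?_) (hg i)
    rw [affSpan_pow]
    exact ⟨_, (p i).2, rfl⟩
  have hinj : Function.Injective (φ.codRestrict _ hφ) := by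
    rw [← LinearMap.ker_eq_bot, LinearMap.ker_codRestrict, LinearMap.ker_eq_bot']
    intro p hp
    rw [Fintype.linearIndependent_iff] at hli
    have := hli (fun i => ⟨aeval f (p i : MvPolynomial (Fin d) K), aeval_mem_adjoin f _⟩) hp
    funext i
    have h1 := congrArg Subtype.val (this i)
    exact Subtype.ext (hf (h1.trans (map_zero (aeval f)).symm))
  have := hfin (s + r₀)
  have h2 := LinearMap.finrank_le_finrank_of_injective hinj
  rwa [Module.finrank_pi_fintype, Finset.sum_const, Finset.card_univ, Fintype.card_fin,
    smul_eq_mul, finrank_restrictTotalDegree] at h2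

/-- A common denominator for a finite-dimensional space of elements. -/
theorem exists_mul_le {d N : ℕ} (f : Fin d → Ω)
    (g : Module.Basis (Fin N) (IntermediateField.adjoin K (Set.range f)) Ω)
    (V : Submodule K Ω) (hV : V.FG) :
    ∃ h : Ω, h ≠ 0 ∧ ∃ c, ∀ w ∈ V, h * w ∈ affSpan K f ^ c * Submodule.span K (Set.range g) := by
  have one_mem : (1 : Ω) ∈ affSpan K f := one_mem_affSpan f
  have hpoly : ∀ p : MvPolynomial (Fin d) K, ∃ c, aeval f p ∈ affSpan K f ^ c := fun p =>
    ⟨p.totalDegree, by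
      rw [affSpan_pow]
      exact ⟨p, by rw [SetLike.mem_coe, mem_restrictTotalDegree], rfl⟩⟩
  suffices H : ∃ h : Ω, h ≠ 0 ∧ (∃ c, h ∈ affSpan K f ^ c) ∧
      ∃ c, ∀ w ∈ V, h * w ∈ affSpan K f ^ c * Submodule.span K (Set.range g) by
    obtain ⟨h, h0, -, h1⟩ := H
    exact ⟨h, h0, h1⟩
  induction V, hV using Submodule.fg_induction with
  | singleton x =>
    have key : ∀ s : Finset (Fin N), ∃ h : Ω, h ≠ 0 ∧ (∃ c, h ∈ affSpan K f ^ c) ∧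
        ∃ c, h * ∑ i ∈ s, (g.repr x i : Ω) * g i ∈
          affSpan K f ^ c * Submodule.span K (Set.range g) := by
      intro s
      induction s using Finset.induction_on with
      | empty => exact ⟨1, one_ne_zero, ⟨0, by simp [Submodule.mem_one]⟩, 0, by simp⟩
      | insert i s hi ih =>
        obtain ⟨h, h0, ⟨c₁, hc₁⟩, c₂, hc₂⟩ := ih
        obtain ⟨a, b, hab⟩ := (IntermediateField.mem_adjoin_range_iff K f _).1 (g.repr x i).2
        by_cases hb : aeval f b = 0
        · refine ⟨h, h0, ⟨c₁, hc₁⟩, c₂, ?_⟩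
          rw [Finset.sum_insert hi, hab, hb, div_zero, zero_mul, zero_add]
          exact hc₂
        · obtain ⟨ca, hca⟩ := hpoly a
          obtain ⟨cb, hcb⟩ := hpoly b
          refine ⟨aeval f b * h, mul_ne_zero hb h0, ⟨cb + c₁, ?_⟩, (c₁ + ca) + (cb + c₂), ?_⟩
          · rw [pow_add]; exact Submodule.mul_mem_mul hcb hc₁
          · rw [Finset.sum_insert hi, hab, mul_add]
            refine add_mem ?_ ?_
            · have e : aeval f b * h * (aeval f a / aeval f b * g i) =
                  (h * aeval f a) * g i := by field_simp
              rw [e]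
              refine Submodule.mul_mem_mul (pow_le_pow_of_one_mem one_mem
                (Nat.le_add_right (c₁ + ca) (cb + c₂)) ?_) (Submodule.subset_span ⟨i, rfl⟩)
              rw [pow_add]; exact Submodule.mul_mem_mul hc₁ hca
            · rw [mul_assoc]
              have := Submodule.mul_mem_mul hcb hc₂
              rw [← mul_assoc, ← pow_add] at this
              exact mul_le_mul' (pow_le_pow_of_one_mem one_mem
                (Nat.le_add_left (cb + c₂) (c₁ + ca))) le_rfl this
    obtain ⟨h, h0, hc, c, hc'⟩ := key Finset.univ
    refine ⟨h, h0, hc, c, fun w hw => ?_⟩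
    obtain ⟨k, rfl⟩ := Submodule.mem_span_singleton.1 hw
    have e : ∑ i, (g.repr x i : Ω) * g i = x := g.sum_repr x
    rw [e] at hc'
    rw [mul_smul_comm]
    exact Submodule.smul_mem _ _ hc'
  | sup V₁ V₂ _ _ ih₁ ih₂ =>
    obtain ⟨h₁, h01, ⟨a₁, ha₁⟩, c₁, hc₁⟩ := ih₁
    obtain ⟨h₂, h02, ⟨a₂, ha₂⟩, c₂, hc₂⟩ := ih₂
    refine ⟨h₁ * h₂, mul_ne_zero h01 h02, ⟨a₁ + a₂, by
      rw [pow_add]; exact Submodule.mul_mem_mul ha₁ ha₂⟩, (a₂ + c₁) + (a₁ + c₂), fun w hw => ?_⟩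
    obtain ⟨w₁, hw₁, w₂, hw₂, rfl⟩ := Submodule.mem_sup.1 hw
    rw [mul_add]
    refine add_mem ?_ ?_
    · have := Submodule.mul_mem_mul ha₂ (hc₁ w₁ hw₁)
      rw [← mul_assoc (affSpan K f ^ a₂), ← pow_add] at this
      rw [mul_comm h₁ h₂, mul_assoc]
      exact mul_le_mul' (pow_le_pow_of_one_mem one_mem (Nat.le_add_right _ _)) le_rfl this
    · have := Submodule.mul_mem_mul ha₁ (hc₂ w₂ hw₂)
      rw [← mul_assoc (affSpan K f ^ a₁), ← pow_add] at this
      rw [mul_assoc]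
      exact mul_le_mul' (pow_le_pow_of_one_mem one_mem (Nat.le_add_left _ _)) le_rfl this

theorem exists_finrank_le_mul {d N : ℕ} (f : Fin d → Ω)
    (g : Module.Basis (Fin N) (IntermediateField.adjoin K (Set.range f)) Ω)
    {W : Submodule K Ω} (hfin : ∀ r, FiniteDimensional K ↥(W ^ r)) {r₀ : ℕ}
    (hr₀ : W ^ (r₀ + 1) ≤ affSpan K f * W ^ r₀) :
    ∃ c, ∀ s, Module.finrank K ↥(W ^ (s + r₀)) ≤ N * (s + c + d).choose d := by
  have := hfin r₀
  obtain ⟨h, h0, c, hc⟩ := exists_mul_le f g (W ^ r₀) ((Submodule.fg_iff_finiteDimensional _).2 this)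
  refine ⟨c, fun s => ?_⟩
  set G := Submodule.span K (Set.range g)
  have hG : FiniteDimensional K G := FiniteDimensional.span_of_finite K (Set.finite_range g)
  have hle : (W ^ (s + r₀)).map (LinearMap.mulLeft K h) ≤ affSpan K f ^ (s + c) * G := by
    rw [Submodule.map_le_iff_le_comap, add_comm s r₀]
    refine (IsReduction.pow_add_le hr₀ s).trans ?_
    rw [Submodule.mul_le]
    intro a ha b hb
    rw [Submodule.mem_comap, LinearMap.mulLeft_apply, mul_left_comm, pow_add, mul_assoc]
    exact Submodule.mul_mem_mul ha (hc b hb)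
  have hinj : Function.Injective (LinearMap.mulLeft K h) := fun a b hab => mul_left_cancel₀ h0 hab
  have : FiniteDimensional K ↥(affSpan K f ^ (s + c) * G) := by
    rw [← Submodule.mulMap_range]
    infer_instance
  calc Module.finrank K ↥(W ^ (s + r₀))
      = Module.finrank K ↥((W ^ (s + r₀)).map (LinearMap.mulLeft K h)) :=
        LinearEquiv.finrank_eq (Submodule.equivMapOfInjective _ hinj _)
    _ ≤ Module.finrank K ↥(affSpan K f ^ (s + c) * G) := Submodule.finrank_mono hle
    _ ≤ Module.finrank K ↥(affSpan K f ^ (s + c)) * Module.finrank K G := finrank_mul_le _ _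
    _ ≤ (s + c + d).choose d * N := Nat.mul_le_mul (finrank_affSpan_pow_le f _)
        ((finrank_range_le_card _).trans_eq (Fintype.card_fin N))
    _ = N * (s + c + d).choose d := mul_comm _ _

theorem span_pow_eq_top {ι : Type*} {d : ℕ} {x : ι → Ω} {f : Fin d → Ω} {r₀ : ℕ}
    [Finite ι] (hr₀ : affSpan K x ^ (r₀ + 1) ≤ affSpan K f * affSpan K x ^ r₀)
    (hx : IntermediateField.adjoin K (Set.range x) = ⊤) :
    Submodule.span (IntermediateField.adjoin K (Set.range f)) ((affSpan K x ^ r₀ : Submodule K Ω) : Set Ω) = ⊤ ∧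
    Algebra.adjoin (IntermediateField.adjoin K (Set.range f)) (Set.range x) = ⊤ := by
  set E := IntermediateField.adjoin K (Set.range f)
  set S : Submodule E Ω := Submodule.span E ((affSpan K x ^ r₀ : Submodule K Ω) : Set Ω)
  have hpow : ∀ s, ∀ w ∈ affSpan K x ^ s, w ∈ S := by
    intro s w hw
    have h1 : w ∈ affSpan K x ^ (r₀ + s) :=
      pow_le_pow_of_one_mem (one_mem_affSpan x) (Nat.le_add_left s r₀) hw
    have h2 := IsReduction.pow_add_le hr₀ s h1
    exact Submodule.mul_induction_on h2 (fun a ha b hb =>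
      S.smul_mem (⟨a, affSpan_pow_le_adjoin f s ha⟩ : E) (Submodule.subset_span hb))
      fun a b ha hb => S.add_mem ha hb
  have hle : (Algebra.adjoin E (Set.range x)).toSubmodule ≤ S := by
    rw [Algebra.adjoin_eq_span, Submodule.span_le]
    intro w hw
    have : ∃ s, w ∈ affSpan K x ^ s := by
      induction hw using Submonoid.closure_induction with
      | mem y hy =>
        obtain ⟨i, rfl⟩ := hy
        exact ⟨1, by rw [pow_one]; exact mem_affSpan x i⟩
      | one => exact ⟨1, by rw [pow_one]; exact one_mem_affSpan x⟩
      | mul a b _ _ ha hb =>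
        obtain ⟨s, hs⟩ := ha
        obtain ⟨t, ht⟩ := hb
        exact ⟨s + t, by rw [pow_add]; exact Submodule.mul_mem_mul hs ht⟩
    obtain ⟨s, hs⟩ := this
    exact hpow s w hs
  have hSfin : FiniteDimensional E S := by
    have h1 : (affSpan K x ^ r₀).FG := (Submodule.fg_iff_finiteDimensional _).2 inferInstance
    obtain ⟨t, ht⟩ := h1
    refine Module.Finite.iff_fg.2 ⟨t, ?_⟩
    apply le_antisymm
    · refine Submodule.span_mono fun a ha => ?_
      rw [← ht]
      exact Submodule.subset_span ha
    · refine Submodule.span_le.2 fun a ha => ?_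
      rw [← ht] at ha
      exact Submodule.span_le_restrictScalars K E (t : Set Ω) ha
  have hTfin : FiniteDimensional E ↥(Algebra.adjoin E (Set.range x)) :=
    Submodule.finiteDimensional_of_le hle
  have halg : ∀ y ∈ Set.range x, IsAlgebraic E y := fun y hy => by
    have h1 := Algebra.IsAlgebraic.isAlgebraic (R := E)
      (⟨y, Algebra.subset_adjoin hy⟩ : ↥(Algebra.adjoin E (Set.range x)))
    exact h1.algHom (Algebra.adjoin E (Set.range x)).val
  have htop : IntermediateField.adjoin E (Set.range x) = ⊤ := by
    rw [eq_top_iff]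
    intro w _
    have hw : w ∈ IntermediateField.adjoin K (Set.range x) := hx ▸ IntermediateField.mem_top
    have : IntermediateField.adjoin K (Set.range x) ≤
        (IntermediateField.adjoin E (Set.range x)).restrictScalars K :=
      IntermediateField.adjoin_le_iff.2 (IntermediateField.subset_adjoin E _)
    exact this hw
  have hT : Algebra.adjoin E (Set.range x) = ⊤ := by
    rw [← IntermediateField.adjoin_toSubalgebra_of_isAlgebraic (F := E) halg, htop,
      IntermediateField.top_toSubalgebra]
  refine ⟨?_, hT⟩
  rw [eq_top_iff, ← Algebra.top_toSubmodule, ← hT]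
  exact hle

/-- The degree of the extension generated by a space of growth `v * r ^ d` over the field generated
by a reduction with `d` generators is `d! * v`. -/
theorem finrank_adjoin_eq [Infinite K] {ι : Type*} [Finite ι] {d : ℕ} {x : ι → Ω} {f : Fin d → Ω}
    {v : ℝ} (hv : 0 < v) (hred : IsReduction (affSpan K f) (affSpan K x))
    (hx : IntermediateField.adjoin K (Set.range x) = ⊤)
    (h : Tendsto (fun r : ℕ => (Module.finrank K ↥(affSpan K x ^ r) : ℝ) / (r : ℝ) ^ d)
      atTop (𝓝 v)) :
    FiniteDimensional (IntermediateField.adjoin K (Set.range f)) Ω ∧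
    (Module.finrank (IntermediateField.adjoin K (Set.range f)) Ω : ℝ) = d.factorial * v := by
  have hfin : ∀ r, FiniteDimensional K ↥(affSpan K x ^ r) := fun r => inferInstance
  have hf := hred.algebraicIndependent hv hfin h
  obtain ⟨hfx, r₀, hr₀⟩ := hred
  obtain ⟨hspan, -⟩ := span_pow_eq_top hr₀ hx
  let E := IntermediateField.adjoin K (Set.range f)
  obtain ⟨b, hb, hbspan, hbli⟩ := exists_linearIndependent E ((affSpan K x ^ r₀ : Submodule K Ω) : Set Ω)
  have hΩ : FiniteDimensional E Ω := by
    have h1 : (affSpan K x ^ r₀).FG := (Submodule.fg_iff_finiteDimensional _).2 inferInstance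
    obtain ⟨t, ht⟩ := h1
    refine ⟨t, ?_⟩
    rw [eq_top_iff, ← hspan]
    refine Submodule.span_le.2 fun a ha => ?_
    rw [SetLike.mem_coe, ← ht] at ha
    exact Submodule.span_le_restrictScalars K E (t : Set Ω) ha
  let B : Module.Basis b E Ω := Module.Basis.mk hbli (by
    rw [Subtype.range_coe, hbspan, hspan])
  have hbfin : Finite b := Module.Finite.finite_basis B
  have := Fintype.ofFinite b
  let e : b ≃ Fin (Module.finrank E Ω) :=
    Fintype.equivFinOfCardEq (Module.finrank_eq_card_basis B).symm
  let g := B.reindex e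
  have hg : ∀ i, g i ∈ affSpan K x ^ r₀ := fun i => by
    simp only [g, B, Module.Basis.reindex_apply, Module.Basis.mk_apply]
    exact hb (e.symm i).2
  refine ⟨hΩ, ?_⟩
  have hshift := tendsto_shift r₀ h
  let N := Module.finrank E Ω
  have hfact : (0 : ℝ) < d.factorial := by positivity
  have hlow : (N : ℝ) * (1 / d.factorial) ≤ v := by
    refine le_of_tendsto_of_tendsto' ((tendsto_add_choose_div_pow d 0).const_mul (N : ℝ)) hshift
      fun s => ?_
    rw [add_zero, ← mul_div_assoc]
    gcongr
    exact_mod_cast mul_finrank_le hf hfin hfx hg g.linearIndependent s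
  obtain ⟨c, hc⟩ := exists_finrank_le_mul f g hfin hr₀
  have hup : v ≤ (N : ℝ) * (1 / d.factorial) := by
    refine le_of_tendsto_of_tendsto' hshift ((tendsto_add_choose_div_pow d c).const_mul (N : ℝ))
      fun s => ?_
    rw [← mul_div_assoc]
    gcongr
    exact_mod_cast hc s
  have hv' : v = (N : ℝ) * (1 / d.factorial) := le_antisymm hup hlow
  rw [hv']
  field_simp
  rfl

end Degree
end GenericSlice

namespace GenericSlice
section GenericFibre

open Polynomial

variable {B C E Ω : Type*} [CommRing B] [CommRing C] [Field E] [Field Ω]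
  [Algebra B C] [Algebra B E] [Algebra B Ω] [Algebra C Ω] [Algebra E Ω]
  [IsScalarTower B C Ω] [IsScalarTower B E Ω] [IsFractionRing B E]

theorem exists_algebraMap_mul_eq [IsDomain B] (hadj : Algebra.adjoin E (Set.range (algebraMap C Ω)) = ⊤)
    (w : Ω) : ∃ b : B, b ≠ 0 ∧ ∃ c : C, algebraMap B Ω b * w = algebraMap C Ω c := by
  have hw : w ∈ Algebra.adjoin E (Set.range (algebraMap C Ω)) := hadj ▸ Algebra.mem_top
  induction hw using Algebra.adjoin_induction with
  | mem x hx =>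
    obtain ⟨c, rfl⟩ := hx
    exact ⟨1, one_ne_zero, c, by simp⟩
  | algebraMap e =>
    obtain ⟨a, b, hb, rfl⟩ := IsFractionRing.div_surjective (A := B) e
    have hb0 : b ≠ 0 := nonZeroDivisors.ne_zero hb
    have hb1 : algebraMap B E b ≠ 0 := by
      rwa [Ne, IsFractionRing.to_map_eq_zero_iff]
    refine ⟨b, hb0, algebraMap B C a, ?_⟩
    rw [← IsScalarTower.algebraMap_apply B C Ω, IsScalarTower.algebraMap_apply B E Ω b,
      IsScalarTower.algebraMap_apply B E Ω a, ← map_mul, mul_div_cancel₀ _ hb1]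
  | add x y _ _ hx hy =>
    obtain ⟨b, hb, c, hc⟩ := hx
    obtain ⟨b', hb', c', hc'⟩ := hy
    refine ⟨b * b', mul_ne_zero hb hb', algebraMap B C b' * c + algebraMap B C b * c', ?_⟩
    simp only [map_add, map_mul, ← hc, ← hc', ← IsScalarTower.algebraMap_apply B C Ω]
    ring
  | mul x y _ _ hx hy =>
    obtain ⟨b, hb, c, hc⟩ := hx
    obtain ⟨b', hb', c', hc'⟩ := hy
    refine ⟨b * b', mul_ne_zero hb hb', c * c', ?_⟩
    simp only [map_mul, ← hc, ← hc']
    ring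

theorem exists_polynomial_mul_eq [IsDomain B] (S : Finset E[X]) :
    ∃ D : B, D ≠ 0 ∧ ∀ q ∈ S, ∃ q' : B[X], q'.map (algebraMap B E) = Polynomial.C (algebraMap B E D) * q := by
  classical
  obtain ⟨b, hb⟩ := IsLocalization.exist_integer_multiples_of_finset (nonZeroDivisors B)
    (S.biUnion fun q => q.support.image q.coeff)
  refine ⟨b, nonZeroDivisors.ne_zero b.2, fun q hq => ?_⟩
  have : Polynomial.C (algebraMap B E b) * q ∈ Polynomial.lifts (algebraMap B E) := by
    rw [Polynomial.lifts_iff_coeff_lifts]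
    intro n
    rw [coeff_C_mul]
    by_cases hn : q.coeff n = 0
    · exact ⟨0, by rw [hn]; simp⟩
    · obtain ⟨c, hc⟩ := hb (q.coeff n) (Finset.mem_biUnion.2
        ⟨q, hq, Finset.mem_image_of_mem _ (mem_support_iff.2 hn)⟩)
      exact ⟨c, by rw [hc, Algebra.smul_def]⟩
  exact (Polynomial.mem_lifts _).1 this

/-- A ring homomorphism into a field extends along a simple extension after inverting a common
denominator. -/
theorem exists_ringHom_of_root {θ : C} {p : E[X]} (hp : p.Monic)
    (hmin : ∀ g : E[X], aeval (algebraMap C Ω θ) g = 0 ↔ p ∣ g)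
    {D : B} (hD : D ≠ 0) {p' : B[X]} (hp' : p'.map (algebraMap B E) = Polynomial.C (algebraMap B E D) * p)
    {s : Set C} (hs : Algebra.adjoin B s = ⊤)
    (hq : ∀ c ∈ s, ∃ q : B[X], algebraMap B C D * c = aeval θ q)
    {k : Type*} [Field k] (ψ : B →+* k) (hψ : ψ D ≠ 0) (ρ : k) (hρ : eval₂ ψ ρ p' = 0) :
    ∃ ψ' : C →+* k, ψ'.comp (algebraMap B C) = ψ ∧ ψ' θ = ρ := by
  let R := Localization.Away D
  have hD1 : algebraMap B E D ≠ 0 := by rwa [Ne, IsFractionRing.to_map_eq_zero_iff]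
  let j : R →+* E := IsLocalization.Away.lift D (g := algebraMap B E) hD1.isUnit
  let ψ₁ : R →+* k := IsLocalization.Away.lift D (g := ψ) hψ.isUnit
  have hj : ∀ b, j (algebraMap B R b) = algebraMap B E b := fun b => IsLocalization.Away.lift_eq ..
  have hψ₁ : ∀ b, ψ₁ (algebraMap B R b) = ψ b := fun b => IsLocalization.Away.lift_eq ..
  let i : R := IsLocalization.Away.invSelf D
  have hi : algebraMap B R D * i = 1 := IsLocalization.Away.mul_invSelf D
  have hjinj : Function.Injective j := by
    refine (injective_iff_map_eq_zero j).2 fun x hx => ?_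
    obtain ⟨m, b, hb⟩ := IsLocalization.Away.surj D x
    have h1 := congrArg j hb
    rw [map_mul, hx, zero_mul, hj] at h1
    have h2 : b = 0 := by
      rwa [eq_comm, IsFractionRing.to_map_eq_zero_iff] at h1
    rw [h2, map_zero] at hb
    have h3 : IsUnit (algebraMap B R D ^ m) := (IsLocalization.Away.algebraMap_isUnit D).pow m
    exact (h3.mul_left_eq_zero).1 hb
  let p₁ : R[X] := Polynomial.C i * p'.map (algebraMap B R)
  have hji : j i * algebraMap B E D = 1 := by
    rw [← hj, ← map_mul, mul_comm, hi, map_one]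
  have hcomp : j.comp (algebraMap B R) = algebraMap B E := RingHom.ext hj
  have hcomp' : ψ₁.comp (algebraMap B R) = ψ := RingHom.ext hψ₁
  have hp₁ : p₁.map j = p := by
    rw [Polynomial.map_mul, Polynomial.map_C, Polynomial.map_map, hcomp, hp', ← mul_assoc,
      ← Polynomial.C_mul, hji, Polynomial.C_1, one_mul]
  have hp₁m : p₁.Monic := Polynomial.monic_of_injective hjinj (hp₁ ▸ hp)
  let τ : R →+* Ω := (algebraMap E Ω).comp j
  have hτ : ∀ b, τ (algebraMap B R b) = algebraMap B Ω b := fun b => by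
    rw [RingHom.comp_apply, hj, ← IsScalarTower.algebraMap_apply B E Ω]
  have heval : ∀ g : R[X], eval₂ τ (algebraMap C Ω θ) g = aeval (algebraMap C Ω θ) (g.map j) :=
    fun g => by rw [aeval_def, eval₂_map]
  have hroot : eval₂ τ (algebraMap C Ω θ) p₁ = 0 := by
    rw [heval, hp₁, hmin]
  let φ : AdjoinRoot p₁ →+* Ω := AdjoinRoot.lift τ (algebraMap C Ω θ) hroot
  have hφ : Function.Injective φ := by
    refine (injective_iff_map_eq_zero φ).2 fun x hx => ?_
    obtain ⟨g, rfl⟩ := AdjoinRoot.mk_surjective x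
    rw [AdjoinRoot.lift_mk, heval, hmin, ← hp₁] at hx
    rw [AdjoinRoot.mk_eq_zero]
    exact (Polynomial.map_dvd_map j hjinj hp₁m).1 hx
  have hroot' : eval₂ ψ₁ ρ p₁ = 0 := by
    rw [eval₂_mul, eval₂_map, hcomp', hρ, mul_zero]
  let χ : AdjoinRoot p₁ →+* k := AdjoinRoot.lift ψ₁ ρ hroot'
  have hrange : ∀ c, ∃ x, φ x = algebraMap C Ω c := by
    intro c
    have hc : c ∈ Algebra.adjoin B s := hs ▸ Algebra.mem_top
    induction hc using Algebra.adjoin_induction with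
    | mem c hc =>
      obtain ⟨q, hq⟩ := hq c hc
      refine ⟨AdjoinRoot.mk p₁ (Polynomial.C i * q.map (algebraMap B R)), ?_⟩
      have h1 := congrArg (algebraMap C Ω) hq
      rw [map_mul, ← IsScalarTower.algebraMap_apply B C Ω, ← hτ, ← aeval_algebraMap_apply] at h1
      have h2 : τ.comp (algebraMap B R) = algebraMap B Ω := RingHom.ext hτ
      rw [AdjoinRoot.lift_mk, eval₂_mul, eval₂_C, eval₂_map, h2, ← aeval_def, ← h1, ← mul_assoc,
        ← map_mul, mul_comm i, hi, map_one, one_mul]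
    | algebraMap b =>
      refine ⟨AdjoinRoot.of p₁ (algebraMap B R b), ?_⟩
      rw [AdjoinRoot.lift_of, hτ, ← IsScalarTower.algebraMap_apply B C Ω]
    | add x y _ _ hx hy =>
      obtain ⟨x', hx⟩ := hx
      obtain ⟨y', hy⟩ := hy
      exact ⟨x' + y', by rw [map_add, map_add, hx, hy]⟩
    | mul x y _ _ hx hy =>
      obtain ⟨x', hx⟩ := hx
      obtain ⟨y', hy⟩ := hy
      exact ⟨x' * y', by rw [map_mul, map_mul, hx, hy]⟩
  choose l hl using hrange
  let l' : C →+* AdjoinRoot p₁ :=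
    { toFun := l
      map_one' := hφ (by rw [hl, map_one, map_one])
      map_mul' := fun a b => hφ (by rw [hl, map_mul, map_mul, hl, hl])
      map_zero' := hφ (by rw [hl, map_zero, map_zero])
      map_add' := fun a b => hφ (by rw [hl, map_add, map_add, hl, hl]) }
  refine ⟨χ.comp l', RingHom.ext fun b => ?_, ?_⟩
  · have h1 : l (algebraMap B C b) = AdjoinRoot.of p₁ (algebraMap B R b) := hφ (by
      rw [hl, AdjoinRoot.lift_of, hτ, ← IsScalarTower.algebraMap_apply B C Ω])
    change χ (l (algebraMap B C b)) = ψ b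
    rw [h1, AdjoinRoot.lift_of, hψ₁]
  · have h1 : l θ = AdjoinRoot.root p₁ := hφ (by rw [hl, AdjoinRoot.lift_root])
    change χ (l θ) = ρ
    rw [h1, AdjoinRoot.lift_root]

/-- The number of points in a generic geometric fibre of a generically finite extension of domains
of characteristic zero is the degree of the extension. -/
theorem exists_card_fibre_eq [IsDomain B] [CharZero E] [FiniteDimensional E Ω]
    (hC : Function.Injective (algebraMap C Ω)) [Algebra.FiniteType B C]
    (hadj : Algebra.adjoin E (Set.range (algebraMap C Ω)) = ⊤) :
    ∃ D : B, D ≠ 0 ∧ ∀ {k : Type*} [Field k] [IsAlgClosed k] (ψ : B →+* k), ψ D ≠ 0 →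
      Finite {ψ' : C →+* k // ψ'.comp (algebraMap B C) = ψ} ∧
      Nat.card {ψ' : C →+* k // ψ'.comp (algebraMap B C) = ψ} = Module.finrank E Ω := by
  classical
  obtain ⟨α, hα⟩ := Field.exists_primitive_element E Ω
  obtain ⟨b, hb, θ, hθ⟩ := exists_algebraMap_mul_eq (B := B) hadj α
  set t : Ω := algebraMap C Ω θ with ht
  have htop : IntermediateField.adjoin E {t} = ⊤ := by
    rw [eq_top_iff, ← hα, IntermediateField.adjoin_simple_le_iff]
    have hb1 : algebraMap B E b ≠ 0 := by rwa [Ne, IsFractionRing.to_map_eq_zero_iff]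
    have e : α = algebraMap E Ω (algebraMap B E b)⁻¹ * t := by
      rw [← hθ, IsScalarTower.algebraMap_apply B E Ω b, ← mul_assoc, ← map_mul, inv_mul_cancel₀ hb1,
        map_one, one_mul]
    rw [e]
    exact mul_mem (IntermediateField.algebraMap_mem _ _)
      (IntermediateField.mem_adjoin_simple_self _ _)
  have hti : IsIntegral E t := Algebra.IsIntegral.isIntegral t
  have hdeg : (minpoly E t).natDegree = Module.finrank E Ω :=
    (Field.primitive_element_iff_minpoly_natDegree_eq E t).1 htop
  set p := minpoly E t with hp
  have hpm : p.Monic := minpoly.monic hti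
  have hp0 : aeval t p = 0 := minpoly.aeval E t
  obtain ⟨u, v, huv⟩ : p.Separable := Algebra.IsSeparable.isSeparable E t
  have hq : ∀ w : Ω, ∃ q : E[X], aeval t q = w := by
    intro w
    have h1 : w ∈ (IntermediateField.adjoin E {t}).toSubalgebra := by
      rw [htop]; trivial
    rw [IntermediateField.adjoin_simple_toSubalgebra_of_isAlgebraic hti.isAlgebraic,
      Algebra.adjoin_singleton_eq_range_aeval] at h1
    exact h1
  choose q hq using hq
  obtain ⟨s, hs⟩ := (inferInstance : Algebra.FiniteType B C).out
  obtain ⟨D, hD, hlift⟩ := exists_polynomial_mul_eq (B := B)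
    (({p, u, v} : Finset E[X]) ∪ s.image fun c => q (algebraMap C Ω c))
  obtain ⟨p', hp'⟩ := hlift p (by simp)
  obtain ⟨u', hu'⟩ := hlift u (by simp)
  obtain ⟨v', hv'⟩ := hlift v (by simp)
  have hinjE : Function.Injective (algebraMap B E) := IsFractionRing.injective B E
  have hq' : ∀ c ∈ (s : Set C), ∃ r : B[X], algebraMap B C D * c = aeval θ r := by
    intro c hc
    obtain ⟨r, hr⟩ := hlift (q (algebraMap C Ω c))
      (Finset.mem_union_right _ (Finset.mem_image_of_mem _ hc))
    refine ⟨r, hC ?_⟩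
    rw [map_mul, ← IsScalarTower.algebraMap_apply B C Ω, ← aeval_algebraMap_apply,
      ← aeval_map_algebraMap E, hr, map_mul, aeval_C, ← IsScalarTower.algebraMap_apply B E Ω, hq]
  have hpθ : aeval θ p' = 0 := hC (by
    rw [map_zero, ← aeval_algebraMap_apply, ← aeval_map_algebraMap E, hp', map_mul, ← ht, hp0,
      mul_zero])
  have hsep : u' * p' + v' * derivative p' = Polynomial.C (D ^ 2) := by
    apply Polynomial.map_injective _ hinjE
    rw [Polynomial.map_add, Polynomial.map_mul, Polynomial.map_mul, ← derivative_map, hp', hu', hv',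
      derivative_C_mul, Polynomial.map_C, map_pow, C_pow, ← mul_one (Polynomial.C _ ^ 2), ← huv]
    ring
  have hcoeff : p'.coeff p.natDegree = D := hinjE (by
    rw [← coeff_map, hp', coeff_C_mul, hpm.coeff_natDegree, mul_one])
  have hdeg' : p'.natDegree = p.natDegree := by
    have h1 : algebraMap B E D ≠ 0 := by rwa [Ne, IsFractionRing.to_map_eq_zero_iff]
    rw [← natDegree_map_eq_of_injective hinjE p', hp', natDegree_C_mul h1]
  refine ⟨D, hD, fun {k} _ _ ψ hψ => ?_⟩
  set pk := p'.map ψ with hpk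
  have hpkdeg : pk.natDegree = Module.finrank E Ω := by
    rw [← hdeg, ← hdeg', hpk]
    refine natDegree_map_of_leadingCoeff_ne_zero ψ ?_
    rwa [leadingCoeff, hdeg', hcoeff]
  have hpk0 : pk ≠ 0 := by
    intro h0
    have h1 : pk.coeff p.natDegree = ψ D := by rw [hpk, coeff_map, hcoeff]
    rw [h0, coeff_zero] at h1
    exact hψ h1.symm
  have hpksep : pk.Separable := by
    have h1 := congrArg (Polynomial.map ψ) hsep
    rw [Polynomial.map_add, Polynomial.map_mul, Polynomial.map_mul, ← derivative_map,
      Polynomial.map_C, map_pow, ← hpk] at h1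
    refine ⟨Polynomial.C (ψ D ^ 2)⁻¹ * u'.map ψ, Polynomial.C (ψ D ^ 2)⁻¹ * v'.map ψ, ?_⟩
    rw [mul_assoc, mul_assoc, ← mul_add, h1, ← C_mul, inv_mul_cancel₀ (pow_ne_zero 2 hψ), C_1]
  have hcard : pk.roots.toFinset.card = Module.finrank E Ω := by
    rw [Multiset.toFinset_card_of_nodup (nodup_roots hpksep), ← hpkdeg]
    exact (splits_iff_card_roots.1 (IsAlgClosed.splits pk))
  have hev : ∀ ψ' : C →+* k, ψ'.comp (algebraMap B C) = ψ → ∀ r : B[X],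
      ψ' (aeval θ r) = eval₂ ψ (ψ' θ) r := fun ψ' h r => by
    rw [aeval_def, hom_eval₂, h]
  let e : {ψ' : C →+* k // ψ'.comp (algebraMap B C) = ψ} → pk.roots.toFinset := fun ψ' =>
    ⟨ψ'.1 θ, by
      rw [Multiset.mem_toFinset, mem_roots hpk0, IsRoot, hpk, eval_map, ← hev ψ'.1 ψ'.2, hpθ,
        map_zero]⟩
  have he : Function.Bijective e := by
    constructor
    · rintro ⟨ψ₁, h₁⟩ ⟨ψ₂, h₂⟩ h12
      have h12' : ψ₁ θ = ψ₂ θ := congrArg Subtype.val h12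
      refine Subtype.ext (RingHom.ext fun c => ?_)
      change ψ₁ c = ψ₂ c
      have hc : c ∈ Algebra.adjoin B (s : Set C) := hs ▸ Algebra.mem_top
      induction hc using Algebra.adjoin_induction with
      | mem c hc =>
        obtain ⟨r, hr⟩ := hq' c hc
        have e₁ := congrArg ψ₁ hr
        have e₂ := congrArg ψ₂ hr
        rw [map_mul, hev ψ₁ h₁, ← RingHom.comp_apply, h₁] at e₁
        rw [map_mul, hev ψ₂ h₂, ← RingHom.comp_apply, h₂, ← h12', ← e₁] at e₂
        exact (mul_left_cancel₀ hψ e₂).symm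
      | algebraMap b =>
        rw [← RingHom.comp_apply, h₁, ← RingHom.comp_apply, h₂]
      | add x y _ _ hx hy => rw [map_add, map_add, hx, hy]
      | mul x y _ _ hx hy => rw [map_mul, map_mul, hx, hy]
    · rintro ⟨ρ, hρ⟩
      rw [Multiset.mem_toFinset, mem_roots hpk0, IsRoot, hpk, eval_map] at hρ
      obtain ⟨ψ', h₁, h₂⟩ := exists_ringHom_of_root (E := E) (Ω := Ω) hpm
        (fun g => (minpoly.dvd_iff).symm) hD hp' hs hq' ψ hψ ρ hρ
      exact ⟨⟨ψ', h₁⟩, Subtype.ext h₂⟩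
  exact ⟨Finite.of_injective e he.1, by rw [Nat.card_eq_of_bijective e he, Nat.card_eq_fintype_card,
    Fintype.card_coe, hcard]⟩

end GenericFibre
end GenericSlice

namespace GenericSlice
open MvPolynomial

section Parameters

variable {R K Ω T : Type*} [CommRing R] [IsDomain R] [Field K] [Field Ω] [CommRing T]
  [Algebra R K] [IsFractionRing R K] [Algebra K Ω] [Algebra R Ω] [IsScalarTower R K Ω]
  [Algebra R T] [Algebra T Ω] [IsScalarTower R T Ω]

theorem exists_map_eq_C_mul {σ : Type*} (r : MvPolynomial σ K) :
    ∃ c : R, c ≠ 0 ∧ ∃ r' : MvPolynomial σ R,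
      map (algebraMap R K) r' = C (algebraMap R K c) * r := by
  let _ : Algebra (MvPolynomial σ R) (MvPolynomial σ K) := algebraMvPolynomial
  obtain ⟨⟨r', ⟨_, c, hc, rfl⟩⟩, h⟩ := IsLocalization.surj
    ((nonZeroDivisors R).map (MvPolynomial.C (σ := σ))) r
  refine ⟨c, nonZeroDivisors.ne_zero hc, r', ?_⟩
  have h1 : map (algebraMap R K) (MvPolynomial.C c) = C (σ := σ) (algebraMap R K c) := map_C _ _
  rw [← h1, mul_comm]
  exact h.symm

/-- The number of solutions of the generic system `g i = b i`, as a function of parameters. -/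
theorem exists_card_ringHom_eq [CharZero K] {d : ℕ} {f : Fin d → Ω} (hf : AlgebraicIndependent K f)
    (g : Fin d → T) (hg : ∀ i, algebraMap T Ω (g i) = f i)
    (hC : Function.Injective (algebraMap T Ω)) [Algebra.FiniteType R T]
    (hadj : Algebra.adjoin (IntermediateField.adjoin K (Set.range f))
      (Set.range (algebraMap T Ω)) = ⊤)
    [FiniteDimensional (IntermediateField.adjoin K (Set.range f)) Ω] :
    ∃ D : MvPolynomial (Fin d) R, D ≠ 0 ∧ ∀ {k : Type*} [Field k] [IsAlgClosed k]
      (ψ : MvPolynomial (Fin d) R →+* k), ψ D ≠ 0 →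
      Finite {ψ' : T →+* k // ψ'.comp (aeval g).toRingHom = ψ} ∧
      Nat.card {ψ' : T →+* k // ψ'.comp (aeval g).toRingHom = ψ} =
        Module.finrank (IntermediateField.adjoin K (Set.range f)) Ω := by
  let E := IntermediateField.adjoin K (Set.range f)
  have hE : ∀ p : MvPolynomial (Fin d) R, aeval f p = aeval f (map (algebraMap R K) p) := fun p => by
    rw [aeval_map_algebraMap]
  let _ : Algebra (MvPolynomial (Fin d) R) T := (aeval g).toRingHom.toAlgebra
  let _ : Algebra (MvPolynomial (Fin d) R) Ω := (aeval (R := R) f).toRingHom.toAlgebra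
  let τ : MvPolynomial (Fin d) R →+* E := (aeval (R := R) f).toRingHom.codRestrict E.toSubring
    fun p => by
      change aeval f p ∈ E
      rw [hE]
      exact aeval_mem_adjoin f _
  let _ : Algebra (MvPolynomial (Fin d) R) E := τ.toAlgebra
  have hRK : Function.Injective (algebraMap R K) := IsFractionRing.injective R K
  have t1 : IsScalarTower (MvPolynomial (Fin d) R) T Ω := IsScalarTower.of_algebraMap_eq fun p => by
    change aeval f p = algebraMap T Ω (aeval g p)
    rw [← aeval_algebraMap_apply]
    congr 2
    funext i
    exact (hg i).symm
  have t2 : IsScalarTower (MvPolynomial (Fin d) R) E Ω := IsScalarTower.of_algebraMap_eq fun p => rfl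
  have hinj : Function.Injective (algebraMap (MvPolynomial (Fin d) R) E) := by
    intro p q hpq
    have h1 : aeval f p = aeval f q := congrArg (algebraMap E Ω) hpq
    rw [hE, hE] at h1
    exact map_injective _ hRK (hf h1)
  have : FaithfulSMul (MvPolynomial (Fin d) R) E :=
    (faithfulSMul_iff_algebraMap_injective _ _).2 hinj
  have : IsFractionRing (MvPolynomial (Fin d) R) E := IsFractionRing.of_field _ _ fun z => by
    obtain ⟨r, s, hrs⟩ := (IntermediateField.mem_adjoin_range_iff K f _).1 z.2
    obtain ⟨a, ha, r', hr'⟩ := exists_map_eq_C_mul (R := R) r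
    obtain ⟨b, hb, s', hs'⟩ := exists_map_eq_C_mul (R := R) s
    refine ⟨MvPolynomial.C b * r', MvPolynomial.C a * s', Subtype.ext ?_⟩
    have h1 : ∀ c : R, c ≠ 0 → algebraMap R Ω c ≠ 0 := fun c hc => by
      rw [IsScalarTower.algebraMap_apply R K Ω]
      simpa using (map_ne_zero_iff _ hRK).2 hc
    change (z : Ω) = aeval f (MvPolynomial.C b * r') / aeval f (MvPolynomial.C a * s')
    rw [hrs, map_mul, map_mul, hE r', hE s', hr', hs', map_mul, map_mul, aeval_C, aeval_C, aeval_C,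
      aeval_C, ← IsScalarTower.algebraMap_apply R K Ω, ← IsScalarTower.algebraMap_apply R K Ω,
      mul_left_comm, mul_div_mul_left _ _ (h1 a ha), mul_div_mul_left _ _ (h1 b hb)]
  have : CharZero E := charZero_of_injective_algebraMap (algebraMap K E).injective
  have : IsScalarTower R (MvPolynomial (Fin d) R) T := IsScalarTower.of_algebraMap_eq fun c => by
    change _ = aeval g (MvPolynomial.C c)
    rw [aeval_C]
  have : Algebra.FiniteType (MvPolynomial (Fin d) R) T :=
    Algebra.FiniteType.of_restrictScalars_finiteType R _ _
  exact exists_card_fibre_eq (B := MvPolynomial (Fin d) R) (E := E) hC hadj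

end Parameters
end GenericSlice

namespace GenericSlice
open MvPolynomial

section Monomials

set_option linter.unusedSectionVars false

open scoped Pointwise

variable {L : Type*} [AddCommMonoid L] [DecidableEq L] {ι : Type*} [Fintype ι]

/-- The set of `0` and all the exponents `a j`. -/
def exponents (a : ι → L) : Finset L := insert 0 (Finset.univ.image a)

theorem zero_mem_exponents (a : ι → L) : (0 : L) ∈ exponents a := Finset.mem_insert_self _ _

theorem mem_exponents (a : ι → L) (j : ι) : a j ∈ exponents a :=
  Finset.mem_insert_of_mem (Finset.mem_image_of_mem _ (Finset.mem_univ j))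

variable {K A : Type*} [Field K] [CommRing A] [Algebra K A] {m : L → A}

theorem affSpan_pow_eq_span (hm0 : m 0 = 1) (hm : ∀ s t, m (s + t) = m s * m t) (a : ι → L) (r : ℕ) :
    affSpan K (fun j => m (a j)) ^ r = Submodule.span K (m '' (r • exponents a : Finset L)) := by
  induction r with
  | zero => simp [hm0, Submodule.one_eq_span]
  | succ r ih =>
    have h1 : affSpan K (fun j => m (a j)) = Submodule.span K (m '' (exponents a : Finset L)) := by
      rw [affSpan, exponents, Finset.coe_insert, Set.image_insert_eq, hm0, Finset.coe_image,
        Finset.coe_univ, Set.image_univ, ← Set.range_comp]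
      rfl
    rw [pow_succ, ih, h1, Submodule.span_mul_span, succ_nsmul, Finset.coe_add]
    congr 1
    ext w
    simp only [Set.mem_mul, Set.mem_image, Set.mem_add]
    constructor
    · rintro ⟨_, ⟨s, hs, rfl⟩, _, ⟨t, ht, rfl⟩, rfl⟩
      exact ⟨s + t, ⟨s, hs, t, ht, rfl⟩, hm s t⟩
    · rintro ⟨_, ⟨s, hs, t, ht, rfl⟩, rfl⟩
      exact ⟨_, ⟨s, hs, rfl⟩, _, ⟨t, ht, rfl⟩, (hm s t).symm⟩

theorem finrank_affSpan_pow_eq_card (hm0 : m 0 = 1) (hm : ∀ s t, m (s + t) = m s * m t)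
    (hli : LinearIndependent K m) (a : ι → L) (r : ℕ) :
    Module.finrank K ↥(affSpan K (fun j => m (a j)) ^ r) = (r • exponents a).card := by
  classical
  rw [affSpan_pow_eq_span hm0 hm, ← Finset.coe_image, finrank_span_finset_eq_card,
    Finset.card_image_of_injective _ hli.injective]
  have := hli.linearIndepOn_id.mono (t := m '' (r • exponents a : Finset L))
    (by rintro _ ⟨s, -, rfl⟩; exact ⟨s, rfl⟩)
  rw [Finset.coe_image]
  exact this

/-- The exponent of a linear form in `1` and the monomials `m (a j)`. -/
def exponentOrZero (a : ι → L) (p : Option ι) : L := p.elim 0 a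

theorem exponentOrZero_mem (a : ι → L) (p : Option ι) : exponentOrZero a p ∈ exponents a := by
  cases p with
  | none => exact zero_mem_exponents a
  | some j => exact mem_exponents a j

theorem exponentOrZero_add_mem (a : ι → L) (p : Option ι) {r : ℕ} {s : L}
    (hs : s ∈ r • exponents a) : exponentOrZero a p + s ∈ (r + 1) • exponents a := by
  rw [succ_nsmul']
  exact Finset.add_mem_add (exponentOrZero_mem a p) hs

/-- The coefficient matrix of the products of the linear forms with coefficients `A` with
monomials, combined with coefficients `X`. -/
def transferMatrix {R : Type*} [CommRing R] {d : ℕ} (a : ι → L) (S S' : Finset L)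
    (X : S' → Option (Fin d) → S → R) (A : Option (Fin d) → Option ι → R) : Matrix S' S' R :=
  fun s s'' => ∑ o, ∑ s', X s o s' * ∑ p, A o p * if exponentOrZero a p + s' = s'' then 1 else 0

theorem transferMatrix_map {R R' : Type*} [CommRing R] [CommRing R'] (φ : R →+* R') {d : ℕ}
    (a : ι → L) (S S' : Finset L) (X : S' → Option (Fin d) → S → R)
    (A : Option (Fin d) → Option ι → R) :
    (transferMatrix a S S' X A).map φ =
      transferMatrix a S S' (fun s o s' => φ (X s o s')) (fun o p => φ (A o p)) := by
  ext s s''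
  simp [transferMatrix, apply_ite φ]

theorem sum_transferMatrix_smul {R A : Type*} [CommRing R] [CommRing A] [Algebra R A] {m : L → A}
    (hm : ∀ s t, m (s + t) = m s * m t) {d : ℕ} (a : ι → L) (r : ℕ)
    (X : ↥((r + 1) • exponents a) → Option (Fin d) → ↥(r • exponents a) → R)
    (U : Option (Fin d) → Option ι → R) (s : ↥((r + 1) • exponents a)) :
    ∑ s'', transferMatrix a _ _ X U s s'' • m s'' =
      ∑ o, ∑ s', X s o s' • ((∑ p, U o p • m (exponentOrZero a p)) * m s') := by
  simp only [transferMatrix, Finset.sum_smul]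
  rw [Finset.sum_comm]
  refine Finset.sum_congr rfl fun o _ => ?_
  rw [Finset.sum_comm]
  refine Finset.sum_congr rfl fun s' _ => ?_
  simp only [mul_smul, Finset.sum_smul]
  rw [← Finset.smul_sum, Finset.sum_comm, Finset.sum_mul]
  congr 1
  refine Finset.sum_congr rfl fun p _ => ?_
  rw [← Finset.smul_sum, smul_mul_assoc, ← hm]
  congr 1
  rw [Finset.sum_eq_single ⟨_, exponentOrZero_add_mem a p s'.2⟩]
  · simp
  · intro t _ ht
    rw [if_neg, zero_smul]
    intro h
    exact ht (Subtype.ext h.symm)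
  · simp

/-- The coefficients of the forms `1` and `∑ j, U i j • m (a j)`. -/
def augment {R : Type*} [CommRing R] {d : ℕ} (U : Fin d → ι → R) :
    Option (Fin d) → Option ι → R
  | none, none => 1
  | none, some _ => 0
  | some _, none => 0
  | some i, some j => U i j

theorem augment_map {R R' : Type*} [CommRing R] [CommRing R'] (φ : R →+* R') {d : ℕ}
    (U : Fin d → ι → R) (o : Option (Fin d)) (p : Option ι) :
    φ (augment U o p) = augment (fun i j => φ (U i j)) o p := by
  cases o <;> cases p <;> simp [augment]

theorem sum_augment_smul {R A : Type*} [CommRing R] [CommRing A] [Algebra R A] {m : L → A}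
    (hm0 : m 0 = 1) {d : ℕ} (a : ι → L) (U : Fin d → ι → R) (o : Option (Fin d)) :
    ∑ p, augment U o p • m (exponentOrZero a p) = o.elim 1 fun i => ∑ j, U i j • m (a j) := by
  cases o <;> simp [augment, exponentOrZero, Fintype.sum_option, hm0]

theorem optionElim_mem_affSpan {d : ℕ} (y : Fin d → A) (o : Option (Fin d)) :
    o.elim 1 y ∈ affSpan K y := by
  cases o with
  | none => exact one_mem_affSpan y
  | some i => exact mem_affSpan y i

theorem affSpan_mul_span_image {d : ℕ} (y : Fin d → A) (S : Finset L) :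
    affSpan K y * Submodule.span K (m '' S) =
      Submodule.span K (Set.range fun p : Option (Fin d) × S => p.1.elim 1 y * m p.2) := by
  rw [affSpan, Submodule.span_mul_span]
  congr 1
  ext w
  simp only [Set.mem_mul, Set.mem_insert_iff, Set.mem_range, Set.mem_image, Prod.exists]
  constructor
  · rintro ⟨_, rfl | ⟨i, rfl⟩, _, ⟨s, hs, rfl⟩, rfl⟩
    · exact ⟨none, ⟨s, hs⟩, rfl⟩
    · exact ⟨some i, ⟨s, hs⟩, rfl⟩
  · rintro ⟨o, s, rfl⟩
    refine ⟨_, ?_, _, ⟨s, s.2, rfl⟩, rfl⟩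
    cases o with
    | none => exact Or.inl rfl
    | some i => exact Or.inr ⟨i, rfl⟩

open Filter Topology in
/-- Generic linear combinations of monomials span a reduction. -/
theorem isReduction_generic {k : Type*} [Field k] [Infinite k] {d : ℕ} {a : ι → L} {v : ℝ}
    (hv : Tendsto (fun r : ℕ => ((r • exponents a).card : ℝ) / (r : ℝ) ^ d) atTop (𝓝 v))
    [Algebra (MvPolynomial (Fin d × ι) k) K]
    (hK : Function.Injective (algebraMap (MvPolynomial (Fin d × ι) k) K))
    (hm0 : m 0 = 1) (hm : ∀ s t, m (s + t) = m s * m t) :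
    IsReduction (affSpan K fun i : Fin d => ∑ j,
        algebraMap (MvPolynomial (Fin d × ι) k) K (X (i, j)) • m (a j))
      (affSpan K fun j => m (a j)) := by
  classical
  let m₁ : L → AddMonoidAlgebra k L := fun s => AddMonoidAlgebra.single s 1
  have hm10 : m₁ 0 = 1 := rfl
  have hm1 : ∀ s t, m₁ (s + t) = m₁ s * m₁ t := fun s t => by
    simp [m₁, AddMonoidAlgebra.single_mul_single]
  have hli : LinearIndependent k m₁ := (AddMonoidAlgebra.basis L k).linearIndependent
  have hgrow : Tendsto (fun r : ℕ => (Module.finrank k ↥(affSpan k (fun j => m₁ (a j)) ^ r) : ℝ) /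
      (r : ℝ) ^ d) atTop (𝓝 v) := by
    simpa only [finrank_affSpan_pow_eq_card hm10 hm1 hli] using hv
  obtain ⟨y, hy, hle, r, hr⟩ := exists_isReduction _ hgrow
  have hy' : ∀ i, ∃ u : ι → k, ∑ j, u j • m₁ (a j) = y i := fun i =>
    (Submodule.mem_span_range_iff_exists_fun k).1 (hy i)
  choose U hU using hy'
  rw [affSpan_pow_eq_span hm10 hm1, affSpan_pow_eq_span hm10 hm1, affSpan_mul_span_image] at hr
  have hX : ∀ s : ↥((r + 1) • exponents a), ∃ c : Option (Fin d) × ↥(r • exponents a) → k,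
      ∑ p, c p • (p.1.elim 1 y * m₁ p.2) = m₁ s := fun s =>
    (Submodule.mem_span_range_iff_exists_fun k).1
      (hr (Submodule.subset_span (Set.mem_image_of_mem _ s.2)))
  choose c hc using hX
  have hone : transferMatrix a _ _ (fun s o s' => c s (o, s')) (augment U) = 1 := by
    ext s s''
    have h1 := sum_transferMatrix_smul hm1 a r (fun s o s' => c s (o, s')) (augment U) s
    simp only [sum_augment_smul hm10, hU] at h1
    rw [← Fintype.sum_prod_type', hc] at h1
    have hli' : LinearIndependent k fun s : ↥((r + 1) • exponents a) => m₁ s :=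
      hli.comp _ Subtype.val_injective
    have h2 : ∑ s'' : ↥((r + 1) • exponents a), (1 : Matrix _ _ k) s s'' • m₁ s'' = m₁ s := by
      simp [Matrix.one_apply]
    rw [← h2] at h1
    exact congrFun (hli'.fintypeLinearCombination_injective h1) s''
  set GR := transferMatrix a (r • exponents a) ((r + 1) • exponents a)
    (fun s o s' => MvPolynomial.C (c s (o, s')))
    (augment fun i j => (X (i, j) : MvPolynomial (Fin d × ι) k)) with hGR
  have hdetR : GR.det ≠ 0 := by
    intro h0
    have h1 : GR.map (eval fun p : Fin d × ι => U p.1 p.2) = 1 := by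
      rw [hGR, transferMatrix_map, ← hone]
      simp only [augment_map, eval_C, eval_X]
    have h2 := congrArg (eval fun p : Fin d × ι => U p.1 p.2) h0
    rw [RingHom.map_det, RingHom.mapMatrix_apply, h1, Matrix.det_one, map_zero] at h2
    exact one_ne_zero h2
  set φ := algebraMap (MvPolynomial (Fin d × ι) k) K
  have hdet : IsUnit (GR.map φ).det := by
    rw [isUnit_iff_ne_zero]
    have := (map_ne_zero_iff φ hK).2 hdetR
    rwa [RingHom.map_det] at this
  refine ⟨affSpan_le (one_mem_affSpan _) fun i => Submodule.sum_mem _ fun j _ =>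
    Submodule.smul_mem _ _ (mem_affSpan (fun j => m (a j)) j), r, ?_⟩
  rw [affSpan_pow_eq_span hm0 hm, affSpan_pow_eq_span hm0 hm, Submodule.span_le]
  rintro _ ⟨s, hs, rfl⟩
  have hM : ∀ s, ∑ s'', (GR.map φ) s s'' • m s'' ∈
      affSpan K (fun i : Fin d => ∑ j, φ (X (i, j)) • m (a j)) *
        Submodule.span K (m '' (r • exponents a : Finset L)) := by
    intro s
    rw [hGR, transferMatrix_map, sum_transferMatrix_smul hm]
    refine Submodule.sum_mem _ fun o _ => Submodule.sum_mem _ fun s' _ => Submodule.smul_mem _ _ ?_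
    refine Submodule.mul_mem_mul ?_ (Submodule.subset_span (Set.mem_image_of_mem _ s'.2))
    simp only [augment_map, sum_augment_smul hm0]
    exact optionElim_mem_affSpan _ o
  have hs' : m s = ∑ s', (GR.map φ)⁻¹ ⟨s, hs⟩ s' • ∑ s'', (GR.map φ) s' s'' • m s'' := by
    simp only [Finset.smul_sum, smul_smul]
    rw [Finset.sum_comm]
    simp only [← Finset.sum_smul, ← Matrix.mul_apply, Matrix.nonsing_inv_mul _ hdet]
    simp [Matrix.one_apply]
  rw [SetLike.mem_coe, hs']
  exact Submodule.sum_mem _ fun s' _ => Submodule.smul_mem _ _ (hM s')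

end Monomials
end GenericSlice

namespace GenericSlice
open MvPolynomial

section Kushnirenko

set_option linter.unusedSectionVars false

open Filter Topology
open scoped Pointwise

theorem exists_sum_of_exists_iterated {k σ τ : Type*} [Field k]
    {D : MvPolynomial τ (MvPolynomial σ k)} (hD : D ≠ 0) :
    ∃ D' : MvPolynomial (σ ⊕ τ) k, D' ≠ 0 ∧ ∀ (A : σ → k) (b : τ → k),
      eval (Sum.elim A b) D' = eval₂Hom (eval A) b D := by
  refine ⟨rename Sum.swap ((sumRingEquiv k τ σ).symm D), ?_, fun A b => ?_⟩
  · rw [Ne, map_eq_zero_iff _ (rename_injective _ Sum.swap_leftInverse.injective)]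
    simpa using hD
  · obtain ⟨p, rfl⟩ := (sumRingEquiv k τ σ).surjective D
    rw [RingEquiv.symm_apply_apply, eval_rename]
    have : (eval (Sum.elim A b ∘ Sum.swap)) =
        (eval₂Hom (eval A) b).comp (sumRingEquiv k τ σ : _ →+* _) := by
      apply ringHom_ext
      · intro r
        simp
      · rintro (i | i) <;>
        simp
    rw [this]
    rfl

variable {L : Type*} [AddCommGroup L] {ι : Type*} [Fintype ι] {d : ℕ}

/-- The linear form `-∑ j, X (i, j) * t ^ a j` in the group algebra over a polynomial ring. -/
noncomputable def genericForm (k : Type*) [Field k] (a : ι → L) (i : Fin d) :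
    AddMonoidAlgebra (MvPolynomial (Fin d × ι) k) L :=
  -∑ j, AddMonoidAlgebra.single (a j) (X (i, j) : MvPolynomial (Fin d × ι) k)

/-- Specialisations of the generic forms correspond to characters solving a linear system. -/
theorem card_characters_eq {k : Type*} [Field k] (a : ι → L) (A : Fin d → ι → k) (b : Fin d → k) :
    Nonempty ({χ : Multiplicative L →* k //
        ∀ i, ∑ j, A i j * χ (Multiplicative.ofAdd (a j)) + b i = 0} ≃
      {ψ' : AddMonoidAlgebra (MvPolynomial (Fin d × ι) k) L →+* k //
        ψ'.comp (aeval (R := MvPolynomial (Fin d × ι) k) (genericForm k a)).toRingHom =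
          eval₂Hom (eval fun p => A p.1 p.2) b}) := by
  have hform : ∀ (ψ' : AddMonoidAlgebra (MvPolynomial (Fin d × ι) k) L →+* k)
      (hψ' : ∀ r, ψ' (AddMonoidAlgebra.single 0 r) = eval (fun p => A p.1 p.2) r) (i),
      ψ' (genericForm k a i) = - ∑ j, A i j * ψ' (AddMonoidAlgebra.single (a j) 1) := by
    intro ψ' hψ' i
    rw [genericForm, map_neg, map_sum]
    congr 1
    refine Finset.sum_congr rfl fun j _ => ?_
    have : (AddMonoidAlgebra.single (a j) (X (i, j)) :
        AddMonoidAlgebra (MvPolynomial (Fin d × ι) k) L) =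
        AddMonoidAlgebra.single 0 (X (i, j)) * AddMonoidAlgebra.single (a j) 1 := by
      rw [AddMonoidAlgebra.single_mul_single, zero_add, mul_one]
    rw [this, map_mul, hψ', eval_X]
  let lft : (Multiplicative L →* k) → (AddMonoidAlgebra (MvPolynomial (Fin d × ι) k) L →+* k) :=
    fun χ => AddMonoidAlgebra.liftNCRingHom (eval fun p => A p.1 p.2) χ fun _ _ => Commute.all _ _
  have hlft : ∀ χ s r, lft χ (AddMonoidAlgebra.single s r) =
      eval (fun p => A p.1 p.2) r * χ (Multiplicative.ofAdd s) := fun χ s r => by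
    exact AddMonoidAlgebra.liftNC_single _ _ _ _
  refine ⟨⟨fun χ => ⟨lft χ.1, ?_⟩, fun ψ' => ⟨⟨⟨fun s => ψ'.1 (AddMonoidAlgebra.single s.toAdd 1),
    ψ'.1.map_one⟩, fun s t => ?_⟩, fun i => ?_⟩, fun χ => ?_, fun ψ' => ?_⟩⟩
  · apply ringHom_ext
    · intro r
      change lft χ.1 (aeval (R := MvPolynomial (Fin d × ι) k) (genericForm k a) (C r)) = _
      rw [aeval_C, coe_eval₂Hom, eval₂_C]
      change lft χ.1 (AddMonoidAlgebra.single 0 r) = _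
      rw [hlft]
      simp
    · intro i
      change lft χ.1 (aeval (R := MvPolynomial (Fin d × ι) k) (genericForm k a) (X i)) = _
      rw [aeval_X, coe_eval₂Hom, eval₂_X, hform _ (fun r => by rw [hlft]; simp)]
      simp only [hlft, map_one, one_mul]
      exact neg_eq_of_add_eq_zero_right (χ.2 i)
  · change ψ'.1 (AddMonoidAlgebra.single (s.toAdd + t.toAdd) 1) = _
    rw [← map_mul, AddMonoidAlgebra.single_mul_single, mul_one]
  · have h1 := RingHom.congr_fun ψ'.2 (X i)
    change ψ'.1 (aeval (R := MvPolynomial (Fin d × ι) k) (genericForm k a) (X i)) = _ at h1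
    rw [aeval_X, coe_eval₂Hom, eval₂_X, hform ψ'.1 (fun r => ?_)] at h1
    · rw [← h1]
      exact add_neg_cancel _
    · have h2 := RingHom.congr_fun ψ'.2 (C r)
      change ψ'.1 (aeval (R := MvPolynomial (Fin d × ι) k) (genericForm k a) (C r)) = _ at h2
      rw [aeval_C, coe_eval₂Hom, eval₂_C] at h2
      exact h2
  · apply Subtype.ext
    ext s
    change lft χ.1 (AddMonoidAlgebra.single s 1) = χ.1 s
    rw [hlft, map_one, one_mul]
    rfl
  · apply Subtype.ext
    apply AddMonoidAlgebra.ringHom_ext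
    · intro r
      have h2 := RingHom.congr_fun ψ'.2 (C r)
      change ψ'.1 (aeval (R := MvPolynomial (Fin d × ι) k) (genericForm k a) (C r)) = _ at h2
      rw [aeval_C, coe_eval₂Hom, eval₂_C] at h2
      change lft _ _ = _
      rw [hlft]
      refine Eq.trans ?_ h2.symm
      exact (congrArg _ ψ'.1.map_one).trans (mul_one _)
    · intro s
      change lft _ _ = _
      rw [hlft, map_one, one_mul]
      rfl

theorem adjoin_monomials_eq_top {R K Ω : Type*} [CommRing R] [Field K] [Field Ω] [Algebra R K]
    [Algebra K Ω] [Algebra R Ω] [IsScalarTower R K Ω] [Algebra (AddMonoidAlgebra R L) Ω]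
    [IsScalarTower R (AddMonoidAlgebra R L) Ω] [IsFractionRing (AddMonoidAlgebra R L) Ω]
    {a : ι → L} (ha : AddSubgroup.closure (Set.range a) = ⊤) :
    IntermediateField.adjoin K (Set.range fun j =>
      algebraMap (AddMonoidAlgebra R L) Ω (AddMonoidAlgebra.single (a j) 1)) = ⊤ := by
  set F := IntermediateField.adjoin K (Set.range fun j =>
      algebraMap (AddMonoidAlgebra R L) Ω (AddMonoidAlgebra.single (a j) 1))
  set m : L → Ω := fun s => algebraMap (AddMonoidAlgebra R L) Ω (AddMonoidAlgebra.single s 1) with hm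
  have hm0 : m 0 = 1 := map_one _
  have hmadd : ∀ s t, m (s + t) = m s * m t := fun s t => by
    rw [hm]
    simp only
    rw [← map_mul, AddMonoidAlgebra.single_mul_single, mul_one]
  have h1 : ∀ s, m s ∈ F := fun s => by
    have hs : s ∈ AddSubgroup.closure (Set.range a) := ha ▸ AddSubgroup.mem_top s
    induction hs using AddSubgroup.closure_induction with
    | mem x hx =>
      obtain ⟨j, rfl⟩ := hx
      exact IntermediateField.subset_adjoin K _ ⟨j, rfl⟩
    | zero => rw [hm0]; exact one_mem F
    | add x y _ _ hx hy => rw [hmadd]; exact mul_mem hx hy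
    | neg x _ hx =>
      have : m (-x) * m x = 1 := by rw [← hmadd, neg_add_cancel, hm0]
      rw [eq_inv_of_mul_eq_one_left this]
      exact inv_mem hx
  have h2 : ∀ c : AddMonoidAlgebra R L, algebraMap (AddMonoidAlgebra R L) Ω c ∈ F := fun c => by
    induction c using AddMonoidAlgebra.induction_on with
    | of s => exact h1 s
    | add f g hf hg => rw [map_add]; exact add_mem hf hg
    | smul r f hf =>
      rw [Algebra.smul_def, map_mul, ← IsScalarTower.algebraMap_apply,
        IsScalarTower.algebraMap_apply R K Ω]
      exact mul_mem (F.algebraMap_mem _) hf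
  rw [eq_top_iff]
  intro w _
  obtain ⟨x, y, -, rfl⟩ := IsFractionRing.div_surjective (A := AddMonoidAlgebra R L) w
  exact div_mem (h2 x) (h2 y)

theorem affSpan_neg {K A σ : Type*} [Field K] [CommRing A] [Algebra K A] (f : σ → A) :
    affSpan K (fun i => -f i) = affSpan K f :=
  le_antisymm (affSpan_le (one_mem_affSpan f) fun i => neg_mem (mem_affSpan f i))
    (affSpan_le (one_mem_affSpan _) fun i =>
      neg_mem_iff.1 (mem_affSpan (K := K) (fun i => -f i) i))

/-- **Kushnirenko's theorem**, with the volume replaced by the growth rate of the sumsets of the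
exponents. -/
theorem exists_card_characters [TwoUniqueSums L] [DecidableEq L] {a : ι → L}
    (ha : AddSubgroup.closure (Set.range a) = ⊤) {v : ℝ} (hv0 : 0 < v)
    (hv : Tendsto (fun r : ℕ => ((r • exponents a).card : ℝ) / (r : ℝ) ^ d) atTop (𝓝 v)) :
    ∃ N : ℕ, (N : ℝ) = d.factorial * v ∧ ∃ D : MvPolynomial ((Fin d × ι) ⊕ Fin d) ℂ, D ≠ 0 ∧
      ∀ (A : Fin d → ι → ℂ) (b : Fin d → ℂ), eval (Sum.elim (fun p => A p.1 p.2) b) D ≠ 0 →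
        Finite {χ : Multiplicative L →* ℂ //
          ∀ i, ∑ j, A i j * χ (Multiplicative.ofAdd (a j)) + b i = 0} ∧
        Nat.card {χ : Multiplicative L →* ℂ //
          ∀ i, ∑ j, A i j * χ (Multiplicative.ofAdd (a j)) + b i = 0} = N := by
  let R := MvPolynomial (Fin d × ι) ℂ
  let K := FractionRing R
  let T := AddMonoidAlgebra R L
  have : IsDomain T := { }
  let Ω := FractionRing T
  have : AddGroup.FG L := ⟨(AddSubgroup.fg_iff _).2 ⟨Set.range a, ha, Set.finite_range a⟩⟩
  have hRT : Function.Injective (algebraMap R T) := fun x y hxy => by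
    simpa using hxy
  have hTΩ : Function.Injective (algebraMap T Ω) := IsFractionRing.injective T Ω
  have : FaithfulSMul R Ω := by
    rw [faithfulSMul_iff_algebraMap_injective, IsScalarTower.algebraMap_eq R T Ω]
    exact hTΩ.comp hRT
  let _ : Algebra K Ω := FractionRing.liftAlgebra R Ω
  have : IsScalarTower R K Ω := inferInstance
  have : CharZero K := charZero_of_injective_algebraMap (algebraMap ℂ K).injective
  have hRK : Function.Injective (algebraMap R K) := IsFractionRing.injective R K
  let m : L → Ω := fun s => algebraMap T Ω (AddMonoidAlgebra.single s 1)
  have hm0 : m 0 = 1 := map_one _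
  have hm : ∀ s t, m (s + t) = m s * m t := fun s t => by
    simp only [m]
    rw [← map_mul, AddMonoidAlgebra.single_mul_single, mul_one]
  have hli : LinearIndependent K m := by
    rw [← LinearIndependent.iff_fractionRing R K]
    exact (AddMonoidAlgebra.basis L R).linearIndependent.map_injOn
      (IsScalarTower.toAlgHom R T Ω).toLinearMap hTΩ.injOn
  have hred := isReduction_generic (K := K) hv hRK hm0 hm
  rw [← affSpan_neg] at hred
  set f : Fin d → Ω := fun i => -∑ j, algebraMap R K (X (i, j)) • m (a j)
  have hgrow : Tendsto (fun r : ℕ => (Module.finrank K ↥(affSpan K (fun j => m (a j)) ^ r) : ℝ) /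
      (r : ℝ) ^ d) atTop (𝓝 v) := by
    simpa only [finrank_affSpan_pow_eq_card hm0 hm hli] using hv
  have hfi := hred.algebraicIndependent hv0 (fun r => inferInstance) hgrow
  have htop : IntermediateField.adjoin K (Set.range fun j => m (a j)) = ⊤ :=
    adjoin_monomials_eq_top (R := R) ha
  obtain ⟨hfd, hN⟩ := finrank_adjoin_eq hv0 hred htop hgrow
  obtain ⟨-, r₀, hr₀⟩ := hred
  have hadj := (span_pow_eq_top hr₀ htop).2
  refine ⟨_, hN, ?_⟩
  have hg : ∀ i, algebraMap T Ω (genericForm ℂ a i) = f i := fun i => by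
    simp only [genericForm, f, map_neg, map_sum]
    congr 1
    refine Finset.sum_congr rfl fun j _ => ?_
    rw [algebraMap_smul, Algebra.smul_def, IsScalarTower.algebraMap_apply R T Ω, ← map_mul]
    congr 1
    change _ = AddMonoidAlgebra.single 0 (X (i, j)) * AddMonoidAlgebra.single (a j) 1
    rw [AddMonoidAlgebra.single_mul_single, zero_add, mul_one]
  have hadj' : Algebra.adjoin (IntermediateField.adjoin K (Set.range f))
      (Set.range (algebraMap T Ω)) = ⊤ := by
    rw [eq_top_iff, ← hadj]
    refine Algebra.adjoin_mono ?_
    rintro _ ⟨j, rfl⟩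
    exact ⟨_, rfl⟩
  obtain ⟨D, hD, hcard⟩ := exists_card_ringHom_eq (R := R) hfi (genericForm ℂ a) hg hTΩ hadj'
  obtain ⟨D', hD', heval⟩ := exists_sum_of_exists_iterated hD
  refine ⟨D', hD', fun A b hAb => ?_⟩
  rw [heval] at hAb
  obtain ⟨h₁, h₂⟩ := hcard _ hAb
  obtain ⟨e⟩ := card_characters_eq a A b
  exact ⟨Finite.of_equiv _ e.symm, (Nat.card_congr e).trans h₂⟩

end Kushnirenko
end GenericSlice

namespace GenericSlice

section LatticePoints

open Filter Topology MeasureTheory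
open scoped Pointwise

theorem sum_nsmul_mem_nsmul_exponents {L ι : Type*} [AddCommMonoid L] [DecidableEq L] [Fintype ι]
    (a : ι → L) (m : ι → ℕ) {r : ℕ} (hm : ∑ j, m j ≤ r) :
    ∑ j, m j • a j ∈ r • exponents a := by
  have key : ∀ s : Finset ι, ∑ j ∈ s, m j • a j ∈ (∑ j ∈ s, m j) • exponents a := by
    classical
    intro s
    induction s using Finset.induction_on with
    | empty => simp
    | insert j s hj ih =>
      rw [Finset.sum_insert hj, Finset.sum_insert hj, add_nsmul]
      exact Finset.add_mem_add (Finset.nsmul_mem_nsmul (mem_exponents a j)) ih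
  exact Finset.nsmul_subset_nsmul_right (zero_mem_exponents a) hm (key Finset.univ)

theorem exists_add_mem_nsmul_exponents {L ι : Type*} [AddCommGroup L] [DecidableEq L] [Fintype ι]
    {a : ι → L} (ha : AddSubgroup.closure (Set.range a) = ⊤) {R : Set L} (hR : R.Finite) :
    ∃ (w : L) (c : ℕ), ∀ x ∈ R, x + w ∈ c • exponents a := by
  have single : ∀ x : L, ∃ (w : L) (c : ℕ), w ∈ c • exponents a ∧ x + w ∈ c • exponents a := by
    intro x
    have hx : x ∈ AddSubgroup.closure (Set.range a) := ha ▸ AddSubgroup.mem_top x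
    induction hx using AddSubgroup.closure_induction with
    | mem x hx =>
      obtain ⟨j, rfl⟩ := hx
      exact ⟨0, 1, by simpa using zero_mem_exponents a, by simpa using mem_exponents a j⟩
    | zero => exact ⟨0, 0, by simp, by simp⟩
    | add x y _ _ hx hy =>
      obtain ⟨w, c, h1, h2⟩ := hx
      obtain ⟨w', c', h3, h4⟩ := hy
      refine ⟨w + w', c + c', ?_, ?_⟩
      · rw [add_nsmul]; exact Finset.add_mem_add h1 h3
      · rw [add_nsmul, add_add_add_comm]; exact Finset.add_mem_add h2 h4
    | neg x _ hx =>
      obtain ⟨w, c, h1, h2⟩ := hx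
      exact ⟨x + w, c, h2, by simpa using h1⟩
  suffices H : ∃ (w : L) (c : ℕ), w ∈ c • exponents a ∧ ∀ x ∈ R, x + w ∈ c • exponents a by
    obtain ⟨w, c, -, h⟩ := H
    exact ⟨w, c, h⟩
  induction R, hR using Set.Finite.induction_on with
  | empty => exact ⟨0, 0, by simp, by simp⟩
  | @insert x R _ _ ih =>
    obtain ⟨w, c, h1, h2⟩ := ih
    obtain ⟨w', c', h3, h4⟩ := single x
    refine ⟨w + w', c + c', ?_, ?_⟩
    · rw [add_nsmul]; exact Finset.add_mem_add h1 h3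
    · rintro y (rfl | hy)
      · rw [add_nsmul, add_left_comm]; exact Finset.add_mem_add h1 h4
      · rw [add_nsmul, ← add_assoc]; exact Finset.add_mem_add (h2 y hy) h3

theorem map_mem_smul_convexHull {L ι V : Type*} [AddCommGroup L] [DecidableEq L] [Fintype ι]
    [AddCommGroup V] [Module ℝ V] (E : L →+ V) (a : ι → L) (r : ℕ) {x : L}
    (hx : x ∈ r • exponents a) :
    E x ∈ (r : ℝ) • convexHull ℝ (insert 0 (Set.range fun j => E (a j))) := by
  set Δ := convexHull ℝ (insert 0 (Set.range fun j => E (a j))) with hΔ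
  have h0 : (0 : V) ∈ Δ := subset_convexHull _ _ (Set.mem_insert _ _)
  induction r generalizing x with
  | zero =>
    rw [zero_nsmul, Finset.mem_zero] at hx
    exact ⟨0, h0, by simp [hx]⟩
  | succ r ih =>
    rw [add_nsmul, one_nsmul] at hx
    obtain ⟨y, hy, s, hs, rfl⟩ := Finset.mem_add.mp hx
    push_cast
    rw [(convex_convexHull ℝ _).add_smul (by positivity) zero_le_one, one_smul, map_add]
    refine Set.add_mem_add (ih hy) ?_
    rw [exponents, Finset.mem_insert, Finset.mem_image] at hs
    rcases hs with rfl | ⟨j, -, rfl⟩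
    · simpa using h0
    · exact subset_convexHull _ _ (Set.mem_insert_of_mem _ ⟨j, rfl⟩)

theorem exists_coeff_of_mem_smul_convexHull {ι V : Type*} [Fintype ι] [AddCommGroup V] [Module ℝ V]
    (u : ι → V) {r : ℝ} (hr : 0 ≤ r) {x : V}
    (hx : x ∈ r • convexHull ℝ (insert 0 (Set.range u))) :
    ∃ t : ι → ℝ, (∀ j, 0 ≤ t j) ∧ ∑ j, t j ≤ r ∧ x = ∑ j, t j • u j := by
  classical
  obtain ⟨y, hy, rfl⟩ := hx
  have hsub : convexHull ℝ (insert 0 (Set.range u)) ⊆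
      {y | ∃ t : ι → ℝ, (∀ j, 0 ≤ t j) ∧ ∑ j, t j ≤ 1 ∧ y = ∑ j, t j • u j} := by
    refine convexHull_min ?_ ?_
    · rintro _ (rfl | ⟨j, rfl⟩)
      · exact ⟨0, by simp, by simp, by simp⟩
      · refine ⟨Pi.single j 1, fun i => ?_, by simp, by simp [Pi.single_apply]⟩
        by_cases h : i = j <;> simp [h]
    · rintro _ ⟨t, ht, ht', rfl⟩ _ ⟨t', h, h', rfl⟩ α β hα hβ hαβ
      refine ⟨fun j => α * t j + β * t' j, fun j => ?_, ?_, ?_⟩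
      · have := ht j; have := h j; positivity
      · rw [Finset.sum_add_distrib, ← Finset.mul_sum, ← Finset.mul_sum]
        nlinarith
      · simp only [add_smul, mul_smul, Finset.sum_add_distrib, Finset.smul_sum]
  obtain ⟨t, ht, ht', rfl⟩ := hsub hy
  refine ⟨fun j => r * t j, fun j => mul_nonneg hr (ht j), ?_, ?_⟩
  · rw [← Finset.mul_sum]; nlinarith
  · simp only [mul_smul, Finset.smul_sum]

theorem tendsto_of_shift_between {u N : ℕ → ℕ} {v : ℝ} {d c : ℕ}
    (hN : Tendsto (fun r : ℕ => (N r : ℝ) / (r : ℝ) ^ d) atTop (𝓝 v))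
    (h1 : ∀ r, u r ≤ N r) (h2 : ∀ r, N r ≤ u (r + c)) :
    Tendsto (fun r : ℕ => (u r : ℝ) / (r : ℝ) ^ d) atTop (𝓝 v) := by
  have h3 : Tendsto (fun r : ℕ => (u (r + c) : ℝ) / (r : ℝ) ^ d) atTop (𝓝 v) := by
    refine tendsto_of_tendsto_of_tendsto_of_le_of_le hN
      (tendsto_shift (u := fun r => (N r : ℝ)) c hN) (fun r => ?_) (fun r => ?_)
    · exact div_le_div_of_nonneg_right (Nat.cast_le.mpr (h2 r)) (by positivity)
    · exact div_le_div_of_nonneg_right (Nat.cast_le.mpr (h1 (r + c))) (by positivity)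
  rw [← tendsto_add_atTop_iff_nat c]
  have h4 : Tendsto (fun r : ℕ => ((r : ℝ) / (r + c : ℕ)) ^ d) atTop (𝓝 (1 ^ d)) := by
    refine Tendsto.pow ?_ d
    have := (tendsto_natCast_div_add_atTop (𝕜 := ℝ) (c : ℝ))
    simpa using this
  have h5 := h3.mul h4
  rw [one_pow, mul_one] at h5
  refine h5.congr' ?_
  filter_upwards [eventually_gt_atTop 0] with r hr
  have : (0 : ℝ) < r := by exact_mod_cast hr
  have : (0 : ℝ) < (r + c : ℕ) := by exact_mod_cast (by omega)
  rw [div_pow]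
  field_simp

end LatticePoints

end GenericSlice

namespace GenericSlice

section LatticePoints

open Filter Topology MeasureTheory
open scoped Pointwise

/-- The inclusion of the integral points into `ℝᵈ`. -/
def toReal (d : ℕ) : (Fin d → ℤ) →+ (Fin d → ℝ) where
  toFun x l := x l
  map_zero' := by ext; simp
  map_add' x y := by ext; simp

@[simp] theorem toReal_apply {d : ℕ} (x : Fin d → ℤ) (l : Fin d) : toReal d x l = x l := rfl

theorem toReal_injective (d : ℕ) : Function.Injective (toReal d) := fun x y h => by
  ext l
  have := congrFun h l
  simpa using this

theorem volume_convexHull_insert_zero_pos {d : ℕ} {ι : Type*} [Finite ι] (u : ι → Fin d → ℝ)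
    (hu : Submodule.span ℝ (Set.range u) = ⊤) :
    0 < (volume (convexHull ℝ (insert 0 (Set.range u)))).toReal := by
  have hb : Bornology.IsBounded (convexHull ℝ (insert 0 (Set.range u))) :=
    isBounded_convexHull.mpr ((Set.finite_range u).insert 0).isBounded
  refine ENNReal.toReal_pos ?_ hb.measure_lt_top.ne
  have h1 : (interior (convexHull ℝ (insert 0 (Set.range u)))).Nonempty := by
    rw [interior_convexHull_nonempty_iff_affineSpan_eq_top]
    apply SetLike.coe_injective
    rw [affineSpan_insert_zero, hu]
    simp
  exact (Measure.measure_pos_of_nonempty_interior volume h1).ne'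

theorem mem_span_basisFun {d : ℕ} (x : Fin d → ℝ) :
    x ∈ Submodule.span ℤ (Set.range (Pi.basisFun ℝ (Fin d))) ↔ ∃ y, toReal d y = x := by
  rw [Module.Basis.mem_span_iff_repr_mem]
  simp only [Pi.basisFun_repr, Set.mem_range]
  constructor
  · intro h
    choose y hy using h
    exact ⟨y, funext hy⟩
  · rintro ⟨y, rfl⟩ l
    exact ⟨y l, rfl⟩

theorem covolume_span_toReal {d : ℕ} (Λ : AddSubgroup (Fin d → ℤ)) (M : Submodule ℤ (Fin d → ℝ))
    [DiscreteTopology M] [IsZLattice ℝ M] (hM : M.toAddSubgroup = Λ.map (toReal d)) :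
    ZLattice.covolume M = Λ.index := by
  set B := Submodule.span ℤ (Set.range (Pi.basisFun ℝ (Fin d)))
  have hB : B.toAddSubgroup = (⊤ : AddSubgroup (Fin d → ℤ)).map (toReal d) := by
    ext x
    rw [← AddMonoidHom.range_eq_map]
    exact mem_span_basisFun x
  have hMB : M ≤ B := by
    intro x hx
    have : x ∈ M.toAddSubgroup := hx
    rw [hM] at this
    have : x ∈ B.toAddSubgroup := hB ▸ AddSubgroup.map_mono le_top this
    exact this
  have h1 := ZLattice.covolume_div_covolume_eq_relIndex M B hMB
  rw [hB, hM, AddSubgroup.relIndex_map_map_of_injective _ _ (toReal_injective d),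
    AddSubgroup.relIndex_top_right] at h1
  have h2 : ZLattice.covolume B = 1 := by
    rw [ZLattice.covolume_eq_measure_fundamentalDomain B volume
      (ZSpan.isAddFundamentalDomain (Pi.basisFun ℝ (Fin d)) volume)]
    rw [ZSpan.fundamentalDomain_pi_basisFun]
    simp [Measure.real, Real.volume_pi_Ico]
  rw [h2, div_one] at h1
  exact h1

theorem tendsto_card_nsmul_exponents {d : ℕ} {ι : Type*} [Fintype ι] {Λ : AddSubgroup (Fin d → ℤ)}
    [DecidableEq Λ] (a : ι → Λ) (ha : AddSubgroup.closure (Set.range a) = ⊤)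
    (hspan : Submodule.span ℝ (Set.range fun j => toReal d (a j)) = ⊤) :
    Λ.index ≠ 0 ∧
    Tendsto (fun r : ℕ => ((r • exponents a).card : ℝ) / (r : ℝ) ^ d) atTop
      (𝓝 ((volume (convexHull ℝ (insert 0 (Set.range fun j => toReal d (a j))))).toReal
        / Λ.index)) := by
  set u : ι → Fin d → ℝ := fun j => toReal d (a j) with hu
  set Δ := convexHull ℝ (insert 0 (Set.range u)) with hΔ
  set E : Λ →+ (Fin d → ℝ) := (toReal d).comp Λ.subtype with hE
  have hEinj : Function.Injective E := (toReal_injective d).comp Subtype.val_injective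
  set M : Submodule ℤ (Fin d → ℝ) := AddSubgroup.toIntSubmodule (Λ.map (toReal d)) with hM
  have hMΛ : M.toAddSubgroup = Λ.map (toReal d) := by simp [hM]
  have hmem : ∀ x, x ∈ M ↔ ∃ y : Λ, E y = x := by
    intro x
    change x ∈ Λ.map (toReal d) ↔ _
    simp [AddSubgroup.mem_map, hE]
  have hΔb : Bornology.IsBounded Δ :=
    isBounded_convexHull.mpr ((Set.finite_range u).insert 0).isBounded
  have hfin : ∀ t : Set (Fin d → ℝ), Bornology.IsBounded t → {x : Λ | E x ∈ t}.Finite := by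
    intro t ht
    obtain ⟨R, hR⟩ := ht.subset_closedBall 0
    refine ((Set.finite_Icc (fun _ => -⌈R⌉ : Fin d → ℤ) (fun _ => ⌈R⌉)).preimage
      (f := fun x : Λ => (x : Fin d → ℤ)) Subtype.val_injective.injOn).subset fun x hx => ?_
    have h1 : ‖E x‖ ≤ R := by simpa using hR hx
    have h2 : ∀ l, |(x : Fin d → ℤ) l| ≤ ⌈R⌉ := fun l => by
      have h3 := ((norm_le_pi_norm (E x) l).trans h1).trans (Int.le_ceil R)
      rw [Real.norm_eq_abs] at h3
      change |(((x : Fin d → ℤ) l : ℤ) : ℝ)| ≤ _ at h3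
      exact_mod_cast h3
    exact ⟨fun l => (abs_le.mp (h2 l)).1, fun l => (abs_le.mp (h2 l)).2⟩
  have hdisc : DiscreteTopology M := by
    refine DiscreteTopology.of_subset
      (s := (Submodule.span ℤ (Set.range (Pi.basisFun ℝ (Fin d))) : Set (Fin d → ℝ)))
      (inferInstanceAs (DiscreteTopology (Submodule.span ℤ (Set.range (Pi.basisFun ℝ (Fin d))))))
      fun x hx => ?_
    obtain ⟨y, rfl⟩ := (hmem x).mp hx
    exact (mem_span_basisFun _).mpr ⟨y, rfl⟩
  have hZ : IsZLattice ℝ M := by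
    refine ⟨eq_top_iff.mpr (hspan ▸ Submodule.span_mono ?_)⟩
    rintro _ ⟨j, rfl⟩
    exact (hmem _).mpr ⟨a j, rfl⟩
  have hcov := covolume_span_toReal Λ M hMΛ
  refine ⟨fun h => ZLattice.covolume_ne_zero M volume (by rw [hcov, h, Nat.cast_zero]), ?_⟩
  have hlim := ZLattice.covolume.tendsto_card_div_pow M (IsZLattice.basis M) hΔb
    (((Set.finite_range u).insert 0).isCompact_convexHull (𝕜 := ℝ)).isClosed.measurableSet
    ((convex_convexHull ℝ _).addHaar_frontier volume)
  rw [hcov, Fintype.card_fin] at hlim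
  -- the number of lattice points in `r • Δ`
  set N : ℕ → ℕ := fun r => Nat.card {x : Λ | E x ∈ (r : ℝ) • Δ} with hN
  have hΔr : ∀ r : ℕ, {x : Λ | E x ∈ (r : ℝ) • Δ}.Finite := fun r => hfin _ (hΔb.smul₀ _)
  have hNlim : Tendsto (fun r : ℕ => (N r : ℝ) / (r : ℝ) ^ d) atTop
      (𝓝 ((volume Δ).toReal / Λ.index)) := by
    refine hlim.congr' ?_
    filter_upwards [eventually_gt_atTop 0] with r hr
    have hr0 : (r : ℝ) ≠ 0 := by exact_mod_cast hr.ne'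
    congr 2
    refine (Nat.card_congr (Equiv.ofBijective (fun x : {x : Λ | E x ∈ (r : ℝ) • Δ} =>
      (⟨(r : ℝ)⁻¹ • E x, ?_, ?_⟩ : ↥(Δ ∩ (r : ℝ)⁻¹ • (M : Set (Fin d → ℝ))))) ⟨?_, ?_⟩)).symm
    · exact (Set.mem_smul_set_iff_inv_smul_mem₀ hr0 _ _).mp x.2
    · exact Set.smul_mem_smul_set ((hmem _).mpr ⟨_, rfl⟩)
    · intro x y h
      exact Subtype.ext (hEinj (smul_right_injective _ (inv_ne_zero hr0) (congrArg Subtype.val h)))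
    · rintro ⟨_, h1, ⟨w, hw, rfl⟩⟩
      obtain ⟨y, rfl⟩ := (hmem w).mp hw
      exact ⟨⟨y, (Set.mem_smul_set_iff_inv_smul_mem₀ hr0 _ _).mpr h1⟩, rfl⟩
  obtain ⟨w, c, hwc⟩ := exists_add_mem_nsmul_exponents ha
    (R := {x : Λ | E x ∈ (fun t : ι → ℝ => ∑ j, t j • u j) '' Set.Icc 0 1})
    (hfin _ (IsCompact.image isCompact_Icc (by fun_prop)).isBounded)
  refine tendsto_of_shift_between (N := N) (c := c) hNlim (fun r => ?_) (fun r => ?_)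
  · have := Nat.card_mono (hΔr r) (s := (r • exponents a : Finset Λ))
      fun x hx => map_mem_smul_convexHull E a r hx
    rwa [Nat.card_coe_set_eq, Set.ncard_coe_finset] at this
  · have hinj : ∀ x : Λ, E x ∈ (r : ℝ) • Δ → x + w ∈ (r + c) • exponents a := by
      intro x hx
      obtain ⟨t, ht, ht', hxt⟩ := exists_coeff_of_mem_smul_convexHull u (Nat.cast_nonneg r) hx
      have h1 : ∑ j, ⌊t j⌋₊ • a j ∈ r • exponents a := by
        refine sum_nsmul_mem_nsmul_exponents a _ ?_
        have : ((∑ j, ⌊t j⌋₊ : ℕ) : ℝ) ≤ r := by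
          push_cast
          exact (Finset.sum_le_sum fun j _ => Nat.floor_le (ht j)).trans ht'
        exact_mod_cast this
      have h2 := hwc (x - ∑ j, ⌊t j⌋₊ • a j) (by
        refine ⟨fun j => t j - ⌊t j⌋₊, ⟨fun j => ?_, fun j => ?_⟩, ?_⟩
        · simpa using Nat.floor_le (ht j)
        · have := Nat.lt_floor_add_one (t j)
          simp only [Pi.one_apply]; linarith
        · simp only [sub_smul, Finset.sum_sub_distrib, map_sub, map_sum, map_nsmul, hxt]
          congr 1
          refine Finset.sum_congr rfl fun j _ => ?_
          rw [Nat.cast_smul_eq_nsmul]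
          rfl)
      have := Finset.add_mem_add h1 h2
      rw [← add_nsmul] at this
      convert this using 1
      abel
    have := Nat.card_le_card_of_injective
      (fun x : {x : Λ | E x ∈ (r : ℝ) • Δ} => (⟨x + w, hinj x x.2⟩ : ↥((r + c) • exponents a)))
      (fun x y h => Subtype.ext (add_right_cancel (congrArg Subtype.val h)))
    rwa [Nat.card_eq_fintype_card (α := ↥((r + c) • exponents a)), Fintype.card_coe] at this

end LatticePoints

end GenericSlice

namespace GenericSlice

section Characters

open MvPolynomial MeasureTheory

/-- Rescale the coefficients of the `j`-th column of a linear system by `c j`. -/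
noncomputable def rescale {d : ℕ} {ι : Type*} (c : ι → ℂ) :
    MvPolynomial ((Fin d × ι) ⊕ Fin d) ℂ →ₐ[ℂ] MvPolynomial ((Fin d × ι) ⊕ Fin d) ℂ :=
  aeval (Sum.elim (fun p => C (c p.2) * X (Sum.inl p)) fun i => X (Sum.inr i))

theorem eval_rescale {d : ℕ} {ι : Type*} (c : ι → ℂ) (A : Fin d → ι → ℂ) (b : Fin d → ℂ)
    (D : MvPolynomial ((Fin d × ι) ⊕ Fin d) ℂ) :
    eval (Sum.elim (fun p => A p.1 p.2) b) (rescale c D)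
      = eval (Sum.elim (fun p => c p.2 * A p.1 p.2) b) D := by
  induction D using MvPolynomial.induction_on with
  | C r => simp [rescale, algebraMap_eq]
  | add p q hp hq => simp only [map_add, hp, hq]
  | mul_X p x hp =>
    rw [map_mul, map_mul, map_mul, hp]
    rcases x with p | i <;> simp [rescale]

theorem rescale_ne_zero {d : ℕ} {ι : Type*} {c : ι → ℂ} (hc : ∀ j, c j ≠ 0)
    {D : MvPolynomial ((Fin d × ι) ⊕ Fin d) ℂ} (hD : D ≠ 0) : rescale c D ≠ 0 := by
  intro h
  refine hD (MvPolynomial.funext fun x => ?_)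
  have := eval_rescale c (fun i j => (c j)⁻¹ * x (Sum.inl (i, j))) (fun i => x (Sum.inr i)) D
  have hx : (Sum.elim (fun p => c p.2 * ((c p.2)⁻¹ * x (Sum.inl (p.1, p.2))))
      fun i => x (Sum.inr i)) = x := by
    ext1 y
    rcases y with ⟨i, j⟩ | i
    · simp [hc j]
    · rfl
  rw [h, hx, map_zero] at this
  rw [map_zero, this]

variable {M T Λ : Type*} [AddCommGroup M] [AddCommGroup T] [AddCommGroup Λ]

/-- The characters of a product are the pairs of characters of the factors. -/
def characterProdEquiv (e : M ≃+ T × Λ) :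
    (Multiplicative M →* ℂ) ≃ (Multiplicative T →* ℂ) × (Multiplicative Λ →* ℂ) where
  toFun χ := (χ.comp (AddMonoidHom.toMultiplicative
      (e.symm.toAddMonoidHom.comp (AddMonoidHom.inl T Λ))),
    χ.comp (AddMonoidHom.toMultiplicative (e.symm.toAddMonoidHom.comp (AddMonoidHom.inr T Λ))))
  invFun p := p.1.comp (AddMonoidHom.toMultiplicative
      ((AddMonoidHom.fst T Λ).comp e.toAddMonoidHom)) *
    p.2.comp (AddMonoidHom.toMultiplicative ((AddMonoidHom.snd T Λ).comp e.toAddMonoidHom))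
  left_inv χ := by
    ext x
    simp [← map_mul, ← ofAdd_add, ← map_add]
  right_inv p := by
    ext x <;> simp

theorem characterProdEquiv_symm_apply (e : M ≃+ T × Λ)
    (p : (Multiplicative T →* ℂ) × (Multiplicative Λ →* ℂ)) (m : M) :
    (characterProdEquiv e).symm p (Multiplicative.ofAdd m)
      = p.1 (Multiplicative.ofAdd (e m).1) * p.2 (Multiplicative.ofAdd (e m).2) := by
  rfl

theorem card_characters (T : Type*) [AddCommGroup T] [Finite T] :
    Finite (Multiplicative T →* ℂ) ∧ Nat.card (Multiplicative T →* ℂ) = Nat.card T := by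
  have := Fintype.ofFinite T
  refine ⟨Finite.of_equiv (AddChar T ℂ) AddChar.toMonoidHomEquiv, ?_⟩
  rw [Nat.card_eq_fintype_card (α := T), ← AddChar.card_eq (α := T), ← Nat.card_eq_fintype_card]
  exact Nat.card_congr AddChar.toMonoidHomEquiv.symm

/-- The linear system in the characters of `Λ` that results from a linear system in the characters of
`T × Λ` by the choice of the character `ψ` of `T`. -/
def IsSolution (e : M ≃+ T × Λ) {d : ℕ} {ι : Type*} [Fintype ι] (m : ι → M) (z : ι → ℂ)
    (A : Fin d → ι → ℂ) (b : Fin d → ℂ) (ψ : Multiplicative T →* ℂ) (χ : Multiplicative Λ →* ℂ) :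
    Prop :=
  ∀ i, ∑ j, ψ (Multiplicative.ofAdd (e (m j)).1) * z j * A i j *
    χ (Multiplicative.ofAdd (e (m j)).2) + b i = 0

theorem isSolution_characterProdEquiv (e : M ≃+ T × Λ) {d : ℕ} {ι : Type*} [Fintype ι] (m : ι → M)
    (z : ι → ℂ) (A : Fin d → ι → ℂ) (b : Fin d → ℂ) (χ : Multiplicative M →* ℂ) :
    (∀ i, ∑ j, A i j * (χ (Multiplicative.ofAdd (m j)) * z j) + b i = 0) ↔
      IsSolution e m z A b (characterProdEquiv e χ).1 (characterProdEquiv e χ).2 := by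
  obtain ⟨p, rfl⟩ := (characterProdEquiv e).symm.surjective χ
  rw [Equiv.apply_symm_apply]
  refine forall_congr' fun i => iff_of_eq
    (congrArg (· + b i = 0) (Finset.sum_congr rfl fun j _ => ?_))
  rw [characterProdEquiv_symm_apply]
  ring

theorem card_subtype_of_equiv_prod {X Y Z : Type*} [Finite Y] {N : ℕ} (E : X ≃ Y × Z)
    {p : X → Prop} {q : Y → Z → Prop} (h : ∀ x, p x ↔ q (E x).1 (E x).2)
    (hq : ∀ y, Finite {z // q y z} ∧ Nat.card {z // q y z} = N) :
    Finite {x // p x} ∧ Nat.card {x // p x} = Nat.card Y * N := by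
  have := fun y => (hq y).1
  have := Fintype.ofFinite Y
  let E' : {x // p x} ≃ Σ y, {z // q y z} :=
    (E.subtypeEquiv (q := fun t => q t.1 t.2) h).trans (Equiv.subtypeProdEquivSigmaSubtype q)
  refine ⟨Finite.of_equiv _ E'.symm, ?_⟩
  rw [Nat.card_congr E', Nat.card_sigma, Finset.sum_congr rfl fun y _ => (hq y).2, Finset.sum_const,
    Finset.card_univ, ← Nat.card_eq_fintype_card, smul_eq_mul]

theorem exists_card_characters_prod [Finite T] (e : M ≃+ T × Λ) {d N : ℕ} {ι : Type*} [Fintype ι]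
    (m : ι → M) {z : ι → ℂ} (hz : ∀ j, z j ≠ 0)
    (h : ∃ D : MvPolynomial ((Fin d × ι) ⊕ Fin d) ℂ, D ≠ 0 ∧
      ∀ (A : Fin d → ι → ℂ) (b : Fin d → ℂ), eval (Sum.elim (fun p => A p.1 p.2) b) D ≠ 0 →
        Finite {χ : Multiplicative Λ →* ℂ //
          ∀ i, ∑ j, A i j * χ (Multiplicative.ofAdd (e (m j)).2) + b i = 0} ∧
        Nat.card {χ : Multiplicative Λ →* ℂ //
          ∀ i, ∑ j, A i j * χ (Multiplicative.ofAdd (e (m j)).2) + b i = 0} = N) :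
    ∃ D : MvPolynomial ((Fin d × ι) ⊕ Fin d) ℂ, D ≠ 0 ∧
      ∀ (A : Fin d → ι → ℂ) (b : Fin d → ℂ), eval (Sum.elim (fun p => A p.1 p.2) b) D ≠ 0 →
        Finite {χ : Multiplicative M →* ℂ //
          ∀ i, ∑ j, A i j * (χ (Multiplicative.ofAdd (m j)) * z j) + b i = 0} ∧
        Nat.card {χ : Multiplicative M →* ℂ //
          ∀ i, ∑ j, A i j * (χ (Multiplicative.ofAdd (m j)) * z j) + b i = 0}
            = Nat.card T * N := by
  obtain ⟨D, hD, h⟩ := h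
  obtain ⟨hfin, hcard⟩ := card_characters T
  have := Fintype.ofFinite (Multiplicative T →* ℂ)
  let c : (Multiplicative T →* ℂ) → ι → ℂ := fun ψ j =>
    ψ (Multiplicative.ofAdd (e (m j)).1) * z j
  have hc : ∀ ψ j, c ψ j ≠ 0 := fun ψ j =>
    mul_ne_zero ((Group.isUnit _).map ψ).ne_zero (hz j)
  refine ⟨∏ ψ, rescale (c ψ) D, Finset.prod_ne_zero_iff.mpr fun ψ _ => rescale_ne_zero (hc ψ) hD,
    fun A b hAb => ?_⟩
  rw [map_prod, Finset.prod_ne_zero_iff] at hAb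
  have hψ : ∀ ψ, Finite {χ : Multiplicative Λ →* ℂ // IsSolution e m z A b ψ χ} ∧
      Nat.card {χ : Multiplicative Λ →* ℂ // IsSolution e m z A b ψ χ} = N := fun ψ =>
    h (fun i j => c ψ j * A i j) b (by rw [← eval_rescale]; exact hAb ψ (Finset.mem_univ _))
  rw [← hcard]
  exact card_subtype_of_equiv_prod (characterProdEquiv e)
    (isSolution_characterProdEquiv e m z A b) hψ

theorem exists_prod_equiv {d : ℕ} [Module.Finite ℤ M] (π : M →+ (Fin d → ℤ))
    (hπ : ∀ x, π x = 0 → IsOfFinAddOrder x) :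
    Finite π.ker ∧ ∃ e : M ≃+ π.ker × π.range, ∀ x, ((e x).2 : Fin d → ℤ) = π x := by
  refine ⟨?_, ?_⟩
  · have : Module.Finite ℤ π.ker :=
      inferInstanceAs (Module.Finite ℤ (LinearMap.ker π.toIntLinearMap))
    refine Module.finite_of_fg_torsion _ fun x => ?_
    obtain ⟨n, hn, hx⟩ := isOfFinAddOrder_iff_nsmul_eq_zero.mp (hπ x x.2)
    refine ⟨⟨n, mem_nonZeroDivisors_of_ne_zero (by exact_mod_cast hn.ne')⟩, Subtype.ext ?_⟩
    simpa using hx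
  · have : Module.Free ℤ π.range :=
      inferInstanceAs (Module.Free ℤ (LinearMap.range π.toIntLinearMap))
    obtain ⟨σ, hσ⟩ := Module.projective_lifting_property π.rangeRestrict.toIntLinearMap
      LinearMap.id π.rangeRestrict_surjective
    have hσ' : ∀ y, π (σ y) = y := fun y => congrArg Subtype.val (LinearMap.congr_fun hσ y)
    refine ⟨{ toFun := fun x => (⟨x - σ (π.rangeRestrict x), ?_⟩, π.rangeRestrict x)
              invFun := fun p => p.1 + σ p.2
              left_inv := fun x => by simp
              right_inv := fun p => ?_
              map_add' := fun x y => ?_ }, fun x => rfl⟩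
    · rw [AddMonoidHom.mem_ker, map_sub, hσ']
      simp
    · have h1 : π.rangeRestrict (p.1 + σ p.2) = p.2 := by
        ext1
        have : π p.1 = 0 := p.1.2
        simp [hσ', this]
      refine Prod.ext (Subtype.ext ?_) h1
      simp [h1]
    · refine Prod.ext (Subtype.ext ?_) (map_add _ _ _)
      simp only [map_add, Prod.mk_add_mk, AddSubgroup.coe_add]
      abel

/-- Kushnirenko's theorem for the characters of a finitely generated abelian group, twisted by
nonzero weights. -/
theorem exists_card_weighted_characters {d : ℕ} {ι : Type*} [Fintype ι] (π : M →+ (Fin d → ℤ))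
    (hπ : ∀ x, π x = 0 ↔ IsOfFinAddOrder x) {m : ι → M}
    (hm : AddSubgroup.closure (Set.range m) = ⊤)
    (hspan : Submodule.span ℝ (Set.range fun j => toReal d (π (m j))) = ⊤)
    {z : ι → ℂ} (hz : ∀ j, z j ≠ 0) :
    ∃ D : MvPolynomial ((Fin d × ι) ⊕ Fin d) ℂ, D ≠ 0 ∧
      ∀ (A : Fin d → ι → ℂ) (b : Fin d → ℂ), eval (Sum.elim (fun p => A p.1 p.2) b) D ≠ 0 →
        Finite {χ : Multiplicative M →* ℂ //
          ∀ i, ∑ j, A i j * (χ (Multiplicative.ofAdd (m j)) * z j) + b i = 0} ∧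
        (π.range.index * Nat.card {χ : Multiplicative M →* ℂ //
          ∀ i, ∑ j, A i j * (χ (Multiplicative.ofAdd (m j)) * z j) + b i = 0} : ℝ)
            = Nat.card {x : M | IsOfFinAddOrder x} * d.factorial *
              (volume (convexHull ℝ (insert 0 (Set.range fun j => toReal d (π (m j)))))).toReal := by
  classical
  have : Module.Finite ℤ M := Module.Finite.iff_addGroup_fg.mpr
    ⟨(AddSubgroup.fg_iff _).2 ⟨Set.range m, hm, Set.finite_range m⟩⟩
  obtain ⟨hfin, e, he⟩ := exists_prod_equiv π fun x => (hπ x).mp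
  have hcard : Nat.card {x : M | IsOfFinAddOrder x} = Nat.card π.ker :=
    Nat.card_congr (Equiv.subtypeEquivRight fun x => (hπ x).symm)
  let a : ι → π.range := fun j => (e (m j)).2
  have ha : AddSubgroup.closure (Set.range a) = ⊤ := by
    have h1 : Set.range a = ((AddMonoidHom.snd _ _).comp e.toAddMonoidHom : M →+ π.range) '' Set.range m := by
      rw [← Set.range_comp]; rfl
    rw [h1, ← AddMonoidHom.map_closure, hm, ← AddMonoidHom.range_eq_map]
    exact AddMonoidHom.range_eq_top.mpr (Prod.snd_surjective.comp e.surjective)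
  have hspan' : (fun j => toReal d (π (m j))) = fun j => toReal d (a j) := by
    ext1 j; rw [← he]
  rw [hspan'] at hspan ⊢
  have : TwoUniqueSums π.range := TwoUniqueSums.of_injective_addHom
    (π.range.subtype : π.range →+ (Fin d → ℤ)).toAddHom Subtype.val_injective inferInstance
  obtain ⟨hidx, hlim⟩ := tendsto_card_nsmul_exponents a ha hspan
  have hidx' : (π.range.index : ℝ) ≠ 0 := Nat.cast_ne_zero.mpr hidx
  have hvol := volume_convexHull_insert_zero_pos _ hspan
  obtain ⟨N, hN, H⟩ := exists_card_characters ha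
    (div_pos hvol (Nat.cast_pos.mpr (Nat.pos_of_ne_zero hidx))) hlim
  obtain ⟨D, hD, H⟩ := exists_card_characters_prod e m hz H
  refine ⟨D, hD, fun A b hAb => ⟨(H A b hAb).1, ?_⟩⟩
  rw [(H A b hAb).2, hcard]
  push_cast
  rw [hN]
  field_simp

end Characters

end GenericSlice

namespace GenericSlice

section ExtendZero

variable {κ : Type*} [DecidableEq κ]

/-- Extension by zero from a subset of the coordinates. -/
def extendZero (I : Finset κ) : ({i // i ∈ I} → ℤ) →+ (κ → ℤ) where
  toFun a j := if h : j ∈ I then a ⟨j, h⟩ else 0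
  map_zero' := by ext; simp
  map_add' a b := by
    ext j
    by_cases h : j ∈ I <;> simp [h]

theorem extendZero_apply (I : Finset κ) (a : {i // i ∈ I} → ℤ) (j : κ) :
    extendZero I a j = if h : j ∈ I then a ⟨j, h⟩ else 0 := rfl

theorem extendZero_single (I : Finset κ) (j : {i // i ∈ I}) (c : ℤ) :
    extendZero I (Pi.single j c) = Pi.single j.1 c := by
  ext l
  rw [extendZero_apply]
  by_cases h : l = j.1
  · subst h
    simp
  · by_cases hl : l ∈ I
    · have : (⟨l, hl⟩ : {i // i ∈ I}) ≠ j := fun h' => h (by rw [← h'])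
      simp [hl, this, h]
    · simp [hl, h]

end ExtendZero

section Orbits

variable {N M : Type*} [AddCommGroup N] [AddCommGroup M]

/-- The multiplicative group of `ℂ` is an injective abelian group. -/
theorem exists_character_extension {f : N →+ M} (hf : Function.Injective f)
    (χ : N →+ Additive ℂˣ) : ∃ ψ : M →+ Additive ℂˣ, ψ.comp f = χ := by
  have : RootableBy ℂˣ ℕ := rootableByOfPowLeftSurj _ _ fun {n} hn x => by
    obtain ⟨y, hy⟩ := IsAlgClosed.exists_pow_nat_eq (x : ℂ) (Nat.pos_of_ne_zero hn)
    have hy0 : y ≠ 0 := fun h => x.ne_zero (by rw [← hy, h, zero_pow hn])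
    exact ⟨Units.mk0 y hy0, Units.ext (by simpa using hy)⟩
  have : RootableBy ℂˣ ℤ := Group.rootableByIntOfRootableByNat ℂˣ
  have : DivisibleBy (Additive ℂˣ) ℤ :=
    { div := fun a n => Additive.ofMul (RootableBy.root a.toMul n)
      div_zero := fun a => congrArg Additive.ofMul (RootableBy.root_zero a.toMul)
      div_cancel := fun a hn => congrArg Additive.ofMul (RootableBy.root_cancel a.toMul hn) }
  exact (Module.Baer.of_divisible (Additive ℂˣ)).extension_property_addMonoidHom f hf χ

variable {κ : Type*} [Fintype κ]

/-- The character `v ↦ ∏ j, g j ^ v j` of `ℤ ^ κ`. -/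
def monomialCharacter (g : κ → ℂˣ) : (κ → ℤ) →+ Additive ℂˣ where
  toFun v := Additive.ofMul (∏ j, g j ^ v j)
  map_zero' := by simp
  map_add' v w := by simp [zpow_add, Finset.prod_mul_distrib]

theorem monomialCharacter_apply (g : κ → ℂˣ) (v : κ → ℤ) :
    monomialCharacter g v = Additive.ofMul (∏ j, g j ^ v j) := rfl

theorem monomialCharacter_sum {ν : Type*} [Fintype ν] {g : κ → ℂˣ} {F : ν → κ → ℤ}
    (hg : ∀ i, ∏ j, g j ^ F i j = 1) (m : ν → ℤ) :
    monomialCharacter g (fun j => ∑ i, F i j * m i) = 0 := by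
  have : (fun j => ∑ i, F i j * m i) = ∑ i, m i • F i := by
    ext1 j
    simp [mul_comm]
  rw [this, map_sum]
  refine Finset.sum_eq_zero fun i _ => ?_
  rw [map_zsmul, monomialCharacter_apply, hg]
  simp

theorem map_eq_ofMul_prod [DecidableEq κ] (φ : (κ → ℤ) →+ Additive ℂˣ) (v : κ → ℤ) :
    φ v = Additive.ofMul (∏ j, (φ (Pi.single j 1)).toMul ^ v j) := by
  have hv : v = ∑ j, v j • (Pi.single j 1 : κ → ℤ) := by
    ext1 l
    simp [Finset.sum_apply, Pi.single_apply]
  conv_lhs => rw [hv]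
  rw [map_sum]
  simp only [map_zsmul]
  rw [ofMul_prod]
  rfl

variable [DecidableEq κ]

/-- Restricting to the coordinates in `I` identifies the orbit of a point with support `I` with the
characters of the lattice quotient. -/
theorem exists_torus_iff_exists_character {ν : Type*} [Fintype ν] [DecidableEq ν] {F : ν → κ → ℤ}
    {B : AddSubgroup (κ → ℤ)} (hB : ∀ v, v ∈ B ↔ ∃ m : ν → ℤ, v = fun j => ∑ i, F i j * m i)
    {I : Finset κ} {H : AddSubgroup ({i // i ∈ I} → ℤ)} (hH : ∀ a, a ∈ H ↔ extendZero I a ∈ B)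
    {z : κ → ℂ} (hz : ∀ i, z i ≠ 0 ↔ i ∈ I) (x : κ → ℂ) :
    (∃ g : κ → ℂˣ, (∀ i, ∏ j, g j ^ F i j = 1) ∧ ∀ j, x j = (g j : ℂ) * z j) ↔
      ∃ χ : Multiplicative (({i // i ∈ I} → ℤ) ⧸ H) →* ℂ, x = fun j => if h : j ∈ I then
        χ (Multiplicative.ofAdd (QuotientAddGroup.mk (Pi.single ⟨j, h⟩ 1))) * z j else 0 := by
  constructor
  · rintro ⟨g, hg, hx⟩
    have hle : H ≤ ((monomialCharacter g).comp (extendZero I)).ker := fun a ha => by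
      obtain ⟨m, hm⟩ := (hB _).mp ((hH a).mp ha)
      rw [AddMonoidHom.mem_ker, AddMonoidHom.comp_apply, hm]
      exact monomialCharacter_sum hg m
    let φ : (({i // i ∈ I} → ℤ) ⧸ H) →+ Additive ℂˣ := QuotientAddGroup.lift H _ hle
    refine ⟨(Units.coeHom ℂ).comp (AddMonoidHom.toMultiplicativeLeft φ), ?_⟩
    ext1 j
    rw [hx]
    split_ifs with h
    · congr 1
      have : φ (QuotientAddGroup.mk (Pi.single ⟨j, h⟩ 1)) = Additive.ofMul (g j) := by
        change monomialCharacter g (extendZero I (Pi.single ⟨j, h⟩ 1)) = _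
        rw [extendZero_single, monomialCharacter_apply,
          Finset.prod_eq_single j (fun l _ hl => by simp [hl]) (by simp)]
        simp
      change _ = ((φ (QuotientAddGroup.mk (Pi.single ⟨j, h⟩ 1))).toMul : ℂ)
      rw [this]
      rfl
    · rw [not_not.mp (mt (hz j).mp h), mul_zero]
  · rintro ⟨χ, rfl⟩
    let f : (({i // i ∈ I} → ℤ) ⧸ H) →+ (κ → ℤ) ⧸ B :=
      QuotientAddGroup.map H B (extendZero I) fun a ha => (hH a).mp ha
    have hf : Function.Injective f := by
      rw [injective_iff_map_eq_zero]
      intro x hx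
      induction x using QuotientAddGroup.induction_on with
      | H a =>
        rw [QuotientAddGroup.eq_zero_iff, hH]
        exact (QuotientAddGroup.eq_zero_iff _).mp hx
    obtain ⟨ψ, hψ⟩ := exists_character_extension hf (MonoidHom.toAdditiveRight χ.toHomUnits)
    let φ : (κ → ℤ) →+ Additive ℂˣ := ψ.comp (QuotientAddGroup.mk' B)
    refine ⟨fun j => (φ (Pi.single j 1)).toMul, fun i => ?_, fun j => ?_⟩
    · have h0 : F i ∈ B := (hB _).mpr ⟨Pi.single i 1, by
        ext1 j
        simp [Pi.single_apply]⟩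
      have h1 : φ (F i) = 0 := by
        change ψ (QuotientAddGroup.mk (F i)) = 0
        rw [(QuotientAddGroup.eq_zero_iff _).mpr h0, map_zero]
      rw [map_eq_ofMul_prod] at h1
      exact h1
    · beta_reduce
      split_ifs with h
      · congr 1
        have h1 := DFunLike.congr_fun hψ (QuotientAddGroup.mk (Pi.single ⟨j, h⟩ 1))
        have h2 : φ (Pi.single j 1)
            = ψ (f (QuotientAddGroup.mk (Pi.single ⟨j, h⟩ 1))) := by
          change ψ (QuotientAddGroup.mk _) = ψ (QuotientAddGroup.mk (extendZero I _))
          rw [extendZero_single]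
        rw [AddMonoidHom.comp_apply] at h1
        rw [h2, h1]
        rfl
      · rw [not_not.mp (mt (hz j).mp h), mul_zero]

end Orbits

end GenericSlice

namespace GenericSlice

section Lattices

open Matrix

/-- The columns of an integer matrix with rationally independent rows span the real vector space. -/
theorem span_columns_eq_top {d : ℕ} {ι : Type*} [Fintype ι] {B : Matrix (Fin d) ι ℤ}
    (hB : LinearIndependent ℚ fun l : Fin d => fun i : ι => (B l i : ℚ)) :
    Submodule.span ℝ (Set.range fun i => toReal d (fun l => B l i)) = ⊤ := by
  classical
  have hrank : (B.map (Int.cast : ℤ → ℚ)).rank = d := by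
    simpa using LinearIndependent.rank_matrix (M := B.map (Int.cast : ℤ → ℚ)) hB
  have hsurj : Function.Surjective (B.map (Int.cast : ℤ → ℚ)).mulVec := by
    have : LinearMap.range (B.map (Int.cast : ℤ → ℚ)).mulVecLin = ⊤ :=
      Submodule.eq_top_of_finrank_eq (by
        rw [Module.finrank_fin_fun]
        exact hrank)
    exact LinearMap.range_eq_top.mp this
  obtain ⟨C, hC⟩ := mulVec_surjective_iff_exists_right_inverse.mp hsurj
  have hC' : B.map (Int.cast : ℤ → ℝ) * C.map (Rat.cast : ℚ → ℝ) = 1 := by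
    have := congrArg (fun X => X.map (Rat.castHom ℝ)) hC
    simp only [Matrix.map_mul, Matrix.map_map] at this
    rw [Matrix.map_one _ (by simp) (by simp)] at this
    convert this using 2 <;> ext <;> simp
  have := mulVec_surjective_iff_exists_right_inverse.mpr ⟨_, hC'⟩
  have htop : LinearMap.range (B.map (Int.cast : ℤ → ℝ)).mulVecLin = ⊤ :=
    LinearMap.range_eq_top.mpr this
  rw [range_mulVecLin] at htop
  exact htop

/-- The kernel of the last rows of `P` is the saturation of the image of the matrix whose Smith normal
form `P` computes. -/
theorem mulVec_last_rows_eq_zero_iff {n k : ℕ} {F : Matrix (Fin n) (Fin k) ℤ}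
    {P : Matrix (Fin k) (Fin k) ℤ} (hP : IsUnit P.det)
    {Q : Matrix (Fin n) (Fin n) ℤ} (hQ : IsUnit Q.det)
    {s : Fin n → ℤ} (hs : ∀ i, s i ≠ 0) (hnk : n ≤ k)
    (hSNF : ∀ (i : Fin k) (j : Fin n),
      (P * F.transpose * Q) i j = if (i : ℕ) = (j : ℕ) then s j else 0)
    {P'' : Matrix (Fin (k - n)) (Fin k) ℤ}
    (hP'' : ∀ l j, P'' l j = P ⟨n + l.1, by have := l.2; omega⟩ j) (v : Fin k → ℤ) :
    P'' *ᵥ v = 0 ↔ ∃ N : ℕ, 0 < N ∧ ∃ m : Fin n → ℤ, N • v = Fᵀ *ᵥ m := by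
  have hrow : ∀ (l : Fin (k - n)) (w : Fin k → ℤ),
      (P'' *ᵥ w) l = (P *ᵥ w) ⟨n + l.1, by have := l.2; omega⟩ := fun l w => by
    simp [mulVec, dotProduct, hP'']
  have hdiag : ∀ (y : Fin n → ℤ) (i : Fin k), ((P * Fᵀ * Q) *ᵥ y) i
      = ∑ j : Fin n, (if (i : ℕ) = (j : ℕ) then s j else 0) * y j := fun y i => by
    rw [mulVec, dotProduct]
    exact Finset.sum_congr rfl fun j _ => congrArg (· * y j) (hSNF i j)
  have hPinv : ∀ {u w : Fin k → ℤ}, P *ᵥ u = P *ᵥ w → u = w := fun h =>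
    mulVec_injective_of_isUnit ((isUnit_iff_isUnit_det _).mpr hP) h
  constructor
  · intro h
    let N := ∏ j, s j
    have hN : N ≠ 0 := Finset.prod_ne_zero_iff.mpr fun i _ => hs i
    have hdvd : ∀ j, s j ∣ N := fun j => Finset.dvd_prod_of_mem s (Finset.mem_univ j)
    choose t ht using hdvd
    let y : Fin n → ℤ := fun j => t j * (P *ᵥ v) ⟨j, by omega⟩
    have hy : N • v = Fᵀ *ᵥ (Q *ᵥ y) := by
      apply hPinv
      rw [mulVec_mulVec, mulVec_mulVec, mulVec_smul]
      ext i
      rw [Pi.smul_apply, hdiag]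
      by_cases hi : (i : ℕ) < n
      · rw [Finset.sum_eq_single ⟨i, hi⟩ (fun j _ hj => by
          rw [if_neg, zero_mul]
          exact fun h' => hj (Fin.ext h'.symm)) (by simp)]
        simp only [if_true, y, smul_eq_mul]
        rw [ht ⟨i, hi⟩]
        ring
      · have h0 := congrFun h ⟨i - n, by omega⟩
        rw [hrow] at h0
        have hi' : (⟨n + (i - n), by omega⟩ : Fin k) = i := Fin.ext (by simp; omega)
        simp only [hi', Pi.zero_apply] at h0
        rw [h0, smul_zero, Finset.sum_eq_zero]
        intro j _
        rw [if_neg (by omega), zero_mul]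
    rcases Int.natAbs_eq N with h1 | h1
    · refine ⟨N.natAbs, Int.natAbs_pos.mpr hN, Q *ᵥ y, ?_⟩
      rw [← hy, ← natCast_zsmul, ← h1]
    · refine ⟨N.natAbs, Int.natAbs_pos.mpr hN, -(Q *ᵥ y), ?_⟩
      rw [mulVec_neg, ← hy, ← natCast_zsmul, (by omega : (N.natAbs : ℤ) = -N), neg_smul]
  · rintro ⟨N, hN, m, hm⟩
    obtain ⟨y, rfl⟩ : ∃ y, Q *ᵥ y = m :=
      mulVec_surjective_iff_isUnit.mpr ((isUnit_iff_isUnit_det _).mpr hQ) m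
    ext l
    have h1 : (P *ᵥ (N • v)) ⟨n + l.1, by have := l.2; omega⟩ = 0 := by
      rw [hm, mulVec_mulVec, mulVec_mulVec, hdiag]
      refine Finset.sum_eq_zero fun j _ => ?_
      rw [if_neg (by simp; omega), zero_mul]
    rw [mulVec_smul, Pi.smul_apply, ← hrow] at h1
    exact (smul_eq_zero.mp h1).resolve_left hN.ne'

end Lattices

end GenericSlice

namespace GenericSlice

section Slices

open MvPolynomial MeasureTheory Matrix

theorem finite_and_card_of_mem_iff {X Y : Type*} {S : Set X} {p : Y → Prop} {f : Y → X}
    (hf : Function.Injective f) (hS : ∀ x, x ∈ S ↔ ∃ y, p y ∧ x = f y) (hp : Finite {y // p y}) :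
    S.Finite ∧ Nat.card S = Nat.card {y // p y} := by
  obtain rfl : S = f '' {y | p y} := Set.ext fun x => by
    rw [hS]
    exact exists_congr fun y => and_congr_right fun _ => eq_comm
  have : {y | p y}.Finite := hp
  exact ⟨this.image f, Nat.card_image_of_injective hf _⟩

theorem closure_single_eq_top {ι : Type*} [Fintype ι] [DecidableEq ι] (H : AddSubgroup (ι → ℤ)) :
    AddSubgroup.closure (Set.range fun j : ι =>
      (QuotientAddGroup.mk (Pi.single j 1) : (ι → ℤ) ⧸ H)) = ⊤ := by
  rw [eq_top_iff]
  rintro x -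
  induction x using QuotientAddGroup.induction_on with
  | H a =>
    have ha : a = ∑ j, a j • (Pi.single j 1 : ι → ℤ) := by
      ext1 l
      simp [Finset.sum_apply, Pi.single_apply]
    rw [ha]
    change QuotientAddGroup.mk' H _ ∈ _
    rw [map_sum]
    refine sum_mem fun j _ => ?_
    rw [map_zsmul]
    exact zsmul_mem (AddSubgroup.subset_closure (Set.mem_range_self j)) _

theorem character_ext {M : Type*} [AddCommGroup M] {S : Set M} (hS : AddSubgroup.closure S = ⊤)
    {χ ψ : Multiplicative M →* ℂ}
    (h : ∀ x ∈ S, χ (Multiplicative.ofAdd x) = ψ (Multiplicative.ofAdd x)) : χ = ψ := by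
  have hle : AddSubgroup.closure S ≤ Subgroup.toAddSubgroup' (χ.eqLocus ψ) :=
    (AddSubgroup.closure_le _).mpr h
  exact MonoidHom.ext fun x => hle (hS ▸ AddSubgroup.mem_top x.toAdd)

/-- The intersection of the orbit of a point with support `I` with a generic affine subspace of
complementary dimension. -/
theorem exists_card_slice {n k : ℕ} (hnk : n ≤ k) {F : Matrix (Fin n) (Fin k) ℤ}
    {P : Matrix (Fin k) (Fin k) ℤ} (hP : IsUnit P.det)
    {Q : Matrix (Fin n) (Fin n) ℤ} (hQ : IsUnit Q.det)
    {s : Fin n → ℤ} (hs : ∀ i, s i ≠ 0)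
    (hSNF : ∀ (i : Fin k) (j : Fin n),
      (P * F.transpose * Q) i j = if (i : ℕ) = (j : ℕ) then s j else 0)
    {P'' : Matrix (Fin (k - n)) (Fin k) ℤ}
    (hP'' : ∀ l j, P'' l j = P ⟨n + l.1, by have := l.2; omega⟩ j)
    {I : Finset (Fin k)}
    (hrank : LinearIndependent ℚ
      (fun l : Fin (k - n) => fun i : {i // i ∈ I} => (P'' l i.1 : ℚ)))
    {z : Fin k → ℂ} (hz : ∀ i, z i ≠ 0 ↔ i ∈ I)
    {B : AddSubgroup (Fin k → ℤ)}
    (hB : ∀ v, v ∈ B ↔ ∃ m : Fin n → ℤ, v = fun j => ∑ i, F i j * m i)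
    {H : AddSubgroup ({i // i ∈ I} → ℤ)} (hH : ∀ a, a ∈ H ↔ extendZero I a ∈ B) :
    ∃ D : MvPolynomial ((Fin (k - n) × Fin k) ⊕ Fin (k - n)) ℂ, D ≠ 0 ∧
      ∀ (A : Matrix (Fin (k - n)) (Fin k) ℂ) (b : Fin (k - n) → ℂ),
        eval (Sum.elim (fun p => A p.1 p.2) b) D ≠ 0 →
          {x : Fin k → ℂ |
              (∃ g : Fin k → ℂˣ,
                (∀ i, ∏ j, g j ^ F i j = 1) ∧ ∀ j, x j = (g j : ℂ) * z j) ∧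
              ∀ i, ∑ j, A i j * x j + b i = 0}.Finite ∧
          ((AddSubgroup.closure
              {v : Fin (k - n) → ℤ | ∃ i ∈ I, v = fun l => P'' l i}).index *
            Nat.card {x : Fin k → ℂ |
              (∃ g : Fin k → ℂˣ,
                (∀ i, ∏ j, g j ^ F i j = 1) ∧ ∀ j, x j = (g j : ℂ) * z j) ∧
              ∀ i, ∑ j, A i j * x j + b i = 0} : ℝ)
            = Nat.card {x : ({i // i ∈ I} → ℤ) ⧸ H | IsOfFinAddOrder x} *
              (k - n).factorial * (volume (convexHull ℝ (insert 0
                {v : Fin (k - n) → ℝ | ∃ i ∈ I, v = fun l => (P'' l i : ℝ)}))).toReal := by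
  let M := ({i // i ∈ I} → ℤ) ⧸ H
  let m : {i // i ∈ I} → M := fun j => QuotientAddGroup.mk (Pi.single j 1)
  have hBF : ∀ v, v ∈ B ↔ ∃ y : Fin n → ℤ, v = Fᵀ *ᵥ y := hB
  have hker := mulVec_last_rows_eq_zero_iff hP hQ hs hnk hSNF hP''
  have hle : H ≤ (P''.mulVecLin.toAddMonoidHom.comp (extendZero I)).ker := fun a ha => by
    obtain ⟨y, hy⟩ := (hBF _).mp ((hH a).mp ha)
    exact (hker (extendZero I a)).mpr ⟨1, one_pos, y, by rw [one_smul, hy]⟩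
  let π : M →+ (Fin (k - n) → ℤ) := QuotientAddGroup.lift H _ hle
  have hπ : ∀ x, π x = 0 ↔ IsOfFinAddOrder x := fun x => by
    induction x using QuotientAddGroup.induction_on with
    | H a =>
      rw [isOfFinAddOrder_iff_nsmul_eq_zero]
      refine (hker (extendZero I a)).trans (exists_congr fun N => and_congr_right fun _ => ?_)
      rw [← hBF, ← map_nsmul, ← hH, ← QuotientAddGroup.mk_nsmul]
      exact (QuotientAddGroup.eq_zero_iff _).symm
  have hπm : ∀ j, π (m j) = fun l => P'' l j := fun j => by
    change P'' *ᵥ extendZero I (Pi.single j 1) = _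
    rw [extendZero_single, mulVec_single_one]
    rfl
  have hm : AddSubgroup.closure (Set.range m) = ⊤ := closure_single_eq_top H
  have hspan : Submodule.span ℝ (Set.range fun j => toReal (k - n) (π (m j))) = ⊤ := by
    simp only [hπm]
    exact span_columns_eq_top (B := P''.submatrix id Subtype.val) hrank
  have hidx : π.range = AddSubgroup.closure
      {v : Fin (k - n) → ℤ | ∃ i ∈ I, v = fun l => P'' l i} := by
    rw [AddMonoidHom.range_eq_map, ← hm, AddMonoidHom.map_closure, ← Set.range_comp]
    congr 1
    ext v
    simp only [Set.mem_range, Function.comp_apply, hπm, Subtype.exists, Set.mem_ofPred_eq,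
      exists_prop, eq_comm]
  have hvol : Set.range (fun j => toReal (k - n) (π (m j)))
      = {v : Fin (k - n) → ℝ | ∃ i ∈ I, v = fun l => (P'' l i : ℝ)} := by
    ext v
    simp only [Set.mem_range, hπm, Subtype.exists, Set.mem_ofPred_eq, exists_prop, eq_comm]
    rfl
  obtain ⟨D, hD, hDsol⟩ := exists_card_weighted_characters π hπ hm hspan
    (z := fun j => z j) fun j => (hz j).mpr j.2
  rw [hidx, hvol] at hDsol
  let f : (Multiplicative M →* ℂ) → Fin k → ℂ := fun χ j =>
    if h : j ∈ I then χ (Multiplicative.ofAdd (m ⟨j, h⟩)) * z j else 0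
  have hfI : ∀ χ (j : {i // i ∈ I}), f χ j = χ (Multiplicative.ofAdd (m j)) * z j :=
    fun χ j => dif_pos j.2
  have hf : Function.Injective f := fun χ ψ h => by
    refine character_ext hm ?_
    rintro _ ⟨j, rfl⟩
    have := congrFun h j
    rw [hfI, hfI] at this
    exact mul_right_cancel₀ ((hz j).mpr j.2) this
  have hsum : ∀ (A : Matrix (Fin (k - n)) (Fin k) ℂ) χ i, ∑ j, A i j * f χ j
      = ∑ j : {i // i ∈ I}, A i j * (χ (Multiplicative.ofAdd (m j)) * z j) := fun A χ i => by
    simp only [← hfI]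
    rw [← Finset.sum_subset (Finset.subset_univ I) fun j _ hj => ?_]
    · exact (Finset.sum_coe_sort I fun j => A i j * f χ j).symm
    · rw [show f χ j = 0 from dif_neg hj, mul_zero]
  refine ⟨rename (Sum.map (Prod.map id Subtype.val) id) D,
    (map_ne_zero_iff _ (rename_injective _ ?_)).mpr hD, fun A b hAb => ?_⟩
  · exact Function.Injective.sumMap (Function.injective_id.prodMap Subtype.val_injective)
      Function.injective_id
  rw [eval_rename, Sum.elim_comp_map] at hAb
  obtain ⟨hfin, hcard⟩ := hDsol (fun i j => A i j) b hAb
  obtain ⟨hfin', hcard'⟩ := finite_and_card_of_mem_iff (S := {x : Fin k → ℂ |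
      (∃ g : Fin k → ℂˣ, (∀ i, ∏ j, g j ^ F i j = 1) ∧ ∀ j, x j = (g j : ℂ) * z j) ∧
      ∀ i, ∑ j, A i j * x j + b i = 0}) hf (fun x => by
    rw [Set.mem_ofPred_eq, exists_torus_iff_exists_character hB hH hz]
    constructor
    · rintro ⟨⟨χ, rfl⟩, hx⟩
      exact ⟨χ, fun i => hsum A χ i ▸ hx i, rfl⟩
    · rintro ⟨χ, hχ, rfl⟩
      exact ⟨⟨χ, rfl⟩, fun i => (hsum A χ i).symm ▸ hχ i⟩) hfin
  exact ⟨hfin', by rw [hcard', hcard]⟩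

end Slices

end GenericSlice

/-- Proposition 3.9 (orbit degree, linear-slice count form): for z with support I such
that P''_{:,I} has rank k−n, a generic affine slice A·x + b = 0 meets the orbit G·z in
finitely many points, N of them, with q_I·N = s_I·(k−n)!·vol(Δ^I). -/
theorem stmt_10
    (n k : ℕ) (hn : 0 < n) (hnk : n ≤ k)
    (F : Matrix (Fin n) (Fin k) ℤ) (hF : F.rank = n)
    (P : Matrix (Fin k) (Fin k) ℤ) (hP : IsUnit P.det)
    (Q : Matrix (Fin n) (Fin n) ℤ) (hQ : IsUnit Q.det)
    (s : Fin n → ℤ) (hs : ∀ i, s i ≠ 0)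
    (hSNF : ∀ (i : Fin k) (j : Fin n),
      (P * F.transpose * Q) i j = if (i : ℕ) = (j : ℕ) then s j else 0)
    (P'' : Matrix (Fin (k - n)) (Fin k) ℤ)
    (hP'' : ∀ l j, P'' l j = P ⟨n + l.1, by have := l.2; omega⟩ j)
    (I : Finset (Fin k))
    (hrank : LinearIndependent ℚ
      (fun l : Fin (k - n) => fun i : {i // i ∈ I} => (P'' l i.1 : ℚ)))
    (z : Fin k → ℂ) (hz : ∀ i, z i ≠ 0 ↔ i ∈ I) :
    let imFt : AddSubgroup (Fin k → ℤ) :=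
      AddSubgroup.closure {v : Fin k → ℤ | ∃ m : Fin n → ℤ, v = fun j => ∑ i', F i' j * m i'}
    let PI : ({i // i ∈ I} → ℤ) → ((Fin k → ℤ) ⧸ imFt) :=
      fun a => QuotientAddGroup.mk (fun j => if h : j ∈ I then a ⟨j, h⟩ else 0)
    let kerPI : AddSubgroup ({i // i ∈ I} → ℤ) :=
      AddSubgroup.closure {a : {i // i ∈ I} → ℤ | PI a = 0}
    let sI : ℕ := Nat.card {x : ({i // i ∈ I} → ℤ) ⧸ kerPI | IsOfFinAddOrder x}
    let qI : ℕ :=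
      (AddSubgroup.closure {v : Fin (k - n) → ℤ | ∃ i ∈ I, v = fun l => P'' l i}).index
    let ΔI : Set (Fin (k - n) → ℝ) :=
      convexHull ℝ (insert 0 {v : Fin (k - n) → ℝ | ∃ i ∈ I, v = fun l => (P'' l i : ℝ)})
    ∃ D : MvPolynomial ((Fin (k - n) × Fin k) ⊕ Fin (k - n)) ℂ, D ≠ 0 ∧
      ∀ (A : Matrix (Fin (k - n)) (Fin k) ℂ) (b : Fin (k - n) → ℂ),
        MvPolynomial.eval (Sum.elim (fun p => A p.1 p.2) b) D ≠ 0 →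
          {x : Fin k → ℂ |
              (∃ g : Fin k → ℂˣ,
                (∀ i, ∏ j, g j ^ F i j = 1) ∧ ∀ j, x j = (g j : ℂ) * z j) ∧
              ∀ i, ∑ j, A i j * x j + b i = 0}.Finite ∧
          (qI * Nat.card {x : Fin k → ℂ |
              (∃ g : Fin k → ℂˣ,
                (∀ i, ∏ j, g j ^ F i j = 1) ∧ ∀ j, x j = (g j : ℂ) * z j) ∧
              ∀ i, ∑ j, A i j * x j + b i = 0} : ℝ)
            = (sI : ℝ) * ((k - n).factorial : ℝ) * (MeasureTheory.volume ΔI).toReal := by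
  intro imFt PI kerPI sI qI ΔI
  have himFt : ∀ v, v ∈ imFt ↔ ∃ m : Fin n → ℤ, v = fun j => ∑ i, F i j * m i := fun v => by
    have : imFt = F.transpose.mulVecLin.toAddMonoidHom.range := by
      rw [← AddSubgroup.closure_eq F.transpose.mulVecLin.toAddMonoidHom.range]
      exact congrArg AddSubgroup.closure (Set.ext fun v => exists_congr fun m => eq_comm)
    rw [this]
    exact exists_congr fun m => eq_comm
  have hkerPI : ∀ a, a ∈ kerPI ↔ GenericSlice.extendZero I a ∈ imFt := fun a => by
    have : kerPI = imFt.comap (GenericSlice.extendZero I) := by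
      rw [← AddSubgroup.closure_eq (imFt.comap (GenericSlice.extendZero I))]
      exact congrArg AddSubgroup.closure (Set.ext fun a => QuotientAddGroup.eq_zero_iff _)
    rw [this]
    rfl
  exact GenericSlice.exists_card_slice hnk hP hQ hs hSNF hP'' hrank hz himFt hkerPI
end

section
/- For every z ∈ (ℂˣ)ᵏ, the map G → ℂᵏ, g ↦ (g₁z₁,…,g_kz_k), is injective; consequently the map (μ_{s₁}×⋯×μ_{s_n}) × (ℂˣ)^{k−n} → G·z sending (w,λ) to the point whose j-th coordinate is (∏_{i=1}^n w_i^{P'_{i,j}})·(∏_{l=1}^{k−n} λ_l^{P''_{l,j}})·z_j is a bijection onto the orbit G·z. -/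
open scoped BigOperators

/-- The monomial map attached to an integer matrix `A`, with `j`-th coordinate
`∏ i, x i ^ A i j`. -/
def monomialMap {M ι κ : Type*} [CommGroup M] [Fintype ι] (A : Matrix ι κ ℤ) (x : ι → M) :
    κ → M :=
  fun j => ∏ i, x i ^ A i j

section monomialMap

variable {M ι κ τ : Type*} [CommGroup M] [Fintype ι]

theorem monomialMap_mul [Fintype κ] (A : Matrix ι κ ℤ) (B : Matrix κ τ ℤ) (x : ι → M) :
    monomialMap (A * B) x = monomialMap B (monomialMap A x) := by
  funext t
  simp only [monomialMap, Matrix.mul_apply, ← Finset.prod_zpow, ← zpow_mul]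
  rw [Finset.prod_comm]
  refine Finset.prod_congr rfl fun i _ => ?_
  exact map_sum (zpowersHom M (x i)).toAdditiveRight (fun j => A i j * B j t) Finset.univ

theorem monomialMap_one [DecidableEq ι] (x : ι → M) :
    monomialMap (1 : Matrix ι ι ℤ) x = x := by
  funext j
  simp [monomialMap, Matrix.one_apply]

theorem monomialMap_apply_one (A : Matrix ι κ ℤ) : monomialMap A (1 : ι → M) = 1 := by
  funext j
  simp [monomialMap]

theorem monomialMap_bijective [DecidableEq ι] {A : Matrix ι ι ℤ} (hA : IsUnit A.det) :
    Function.Bijective (monomialMap A : (ι → M) → ι → M) := by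
  refine Function.bijective_iff_has_inverse.2 ⟨monomialMap A⁻¹, fun x => ?_, fun x => ?_⟩
  · rw [← monomialMap_mul, Matrix.mul_nonsing_inv _ hA, monomialMap_one]
  · rw [← monomialMap_mul, Matrix.nonsing_inv_mul _ hA, monomialMap_one]

theorem monomialMap_eq_one_iff [DecidableEq ι] {A : Matrix ι ι ℤ} (hA : IsUnit A.det)
    (x : ι → M) : monomialMap A x = 1 ↔ x = 1 := by
  rw [← (monomialMap_bijective hA).injective.eq_iff (a := x), monomialMap_apply_one]

end monomialMap

theorem Fin.prod_univ_castLE_mul {M : Type*} [CommMonoid M] {n k : ℕ} (hnk : n ≤ k)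
    (f : Fin k → M) :
    ∏ i, f i =
      (∏ i : Fin n, f (Fin.castLE hnk i)) * ∏ l : Fin (k - n), f ⟨n + l.1, by omega⟩ := by
  have h : n + (k - n) = k := by omega
  rw [← (finCongr h).prod_comp f, Fin.prod_univ_add]
  rfl

/-- Concatenation identifies pairs of tuples of lengths `n` and `k - n` with tuples of
length `k`. -/
def Fin.splitEquiv (M : Type*) {n k : ℕ} (hnk : n ≤ k) :
    (Fin k → M) ≃ (Fin n → M) × (Fin (k - n) → M) where
  toFun y := (fun i => y (Fin.castLE hnk i), fun l => y ⟨n + l.1, by omega⟩)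
  invFun p := fun i => if h : i.1 < n then p.1 ⟨i.1, h⟩ else p.2 ⟨i.1 - n, by omega⟩
  left_inv y := by
    funext i
    by_cases h : i.1 < n
    · simp [h]
    · simp [h, Nat.add_sub_cancel' (not_lt.1 h)]
  right_inv p := by
    ext <;> simp

/-- For z ∈ (ℂˣ)ᵏ the action map g ↦ g·z is injective on G, and the orbit
parametrization (w,λ) ↦ ((∏ᵢ wᵢ^{P'_{i,j}})(∏ₗ λₗ^{P''_{l,j}})·z_j)_j is a bijection
from (μ_{s₁}×⋯×μ_{s_n}) × (ℂˣ)^{k−n} onto the orbit G·z. -/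
theorem stmt_16
    (n k : ℕ) (hn : 0 < n) (hnk : n ≤ k)
    (F : Matrix (Fin n) (Fin k) ℤ) (hF : F.rank = n)
    (P : Matrix (Fin k) (Fin k) ℤ) (hP : IsUnit P.det)
    (Q : Matrix (Fin n) (Fin n) ℤ) (hQ : IsUnit Q.det)
    (s : Fin n → ℤ) (hs : ∀ i, s i ≠ 0)
    (hSNF : ∀ (i : Fin k) (j : Fin n),
      (P * F.transpose * Q) i j = if (i : ℕ) = (j : ℕ) then s j else 0)
    (P' : Matrix (Fin n) (Fin k) ℤ) (hP' : ∀ i j, P' i j = P (Fin.castLE hnk i) j)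
    (P'' : Matrix (Fin (k - n)) (Fin k) ℤ)
    (hP'' : ∀ l j, P'' l j = P ⟨n + l.1, by have := l.2; omega⟩ j)
    (z : Fin k → ℂˣ) :
    Set.InjOn (fun g : Fin k → ℂˣ => (fun j => (g j : ℂ) * (z j : ℂ) : Fin k → ℂ))
      {g | ∀ i, ∏ j, g j ^ F i j = 1} ∧
    Set.BijOn
      (fun p : (Fin n → ℂˣ) × (Fin (k - n) → ℂˣ) =>
        (fun j => (((∏ i, p.1 i ^ P' i j) * ∏ l, p.2 l ^ P'' l j : ℂˣ) : ℂ) * (z j : ℂ)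
          : Fin k → ℂ))
      {p | ∀ i, p.1 i ^ s i = 1}
      {x : Fin k → ℂ | ∃ g : Fin k → ℂˣ,
        (∀ i, ∏ j, g j ^ F i j = 1) ∧ ∀ j, x j = (g j : ℂ) * (z j : ℂ)} := by
  have hinj : Function.Injective
      (fun g : Fin k → ℂˣ => (fun j => (g j : ℂ) * (z j : ℂ) : Fin k → ℂ)) := by
    intro g h hgh
    funext j
    exact Units.ext (mul_right_cancel₀ (z j).ne_zero (congrFun hgh j))
  have hG (y : Fin k → ℂˣ) : (∀ i, ∏ j, monomialMap P y j ^ F i j = 1) ↔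
      ∀ i, y (Fin.castLE hnk i) ^ s i = 1 := by
    have h₁ : (∀ i, ∏ j, monomialMap P y j ^ F i j = 1) ↔
        monomialMap F.transpose (monomialMap P y) = 1 := by
      simp [funext_iff, monomialMap]
    rw [h₁, ← monomialMap_mul, ← monomialMap_eq_one_iff hQ, ← monomialMap_mul, funext_iff]
    refine forall_congr' fun i => ?_
    have h₂ : monomialMap (P * F.transpose * Q) y i = y (Fin.castLE hnk i) ^ s i := by
      simp only [monomialMap, hSNF]
      rw [Finset.prod_eq_single (Fin.castLE hnk i)]
      · simp
      · intro j _ hj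
        have hji : (j : ℕ) ≠ i := fun h => hj (Fin.ext h)
        rw [if_neg hji, zpow_zero]
      · simp
    rw [h₂, Pi.one_apply]
  have hparam (y : Fin k → ℂˣ) (j : Fin k) :
      (∏ i, (Fin.splitEquiv ℂˣ hnk y).1 i ^ P' i j) *
        ∏ l, (Fin.splitEquiv ℂˣ hnk y).2 l ^ P'' l j = monomialMap P y j := by
    simp only [monomialMap, hP', hP'']
    exact (Fin.prod_univ_castLE_mul hnk fun i => y i ^ P i j).symm
  refine ⟨hinj.injOn, ?_, ?_, ?_⟩
  · intro p hp
    obtain ⟨y, rfl⟩ := (Fin.splitEquiv ℂˣ hnk).surjective p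
    exact ⟨monomialMap P y, (hG y).2 hp, fun j => by simp only [hparam]⟩
  · intro p _ q _ hpq
    obtain ⟨y, rfl⟩ := (Fin.splitEquiv ℂˣ hnk).surjective p
    obtain ⟨x, rfl⟩ := (Fin.splitEquiv ℂˣ hnk).surjective q
    simp only [hparam] at hpq
    rw [(monomialMap_bijective hP).injective (hinj hpq)]
  · rintro x ⟨g, hg, hx⟩
    obtain ⟨y, rfl⟩ := (monomialMap_bijective hP).surjective g
    refine ⟨Fin.splitEquiv ℂˣ hnk y, (hG y).1 hg, ?_⟩
    funext j
    simp only [hparam, hx]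
end
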